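/- arXiv:math/0011251 — 2 statements merged into one kernel-verified Lean document; each statement's English description precedes it below -/
import Mathlib

section
/- Let A be a standard graded K-algebra, M a finitely generated graded A-module, and let ... → N_r → N_{r-1} → ... → N_1 → N_0 → M → 0 be an exact complex of finitely generated graded A-modules. Let h be a natural number and a an integer such that t_s(N_r) ≤ a + r + s for all 0 ≤ r ≤ h and 0 ≤ s ≤ h − r, where t_s(N) = sup{ j : Tor_s^A(N,K)_j ≠ 0 }. Then t_h(M) ≤ a + h. -/
/-- The `j`-th graded component of the graded free module `σ →₀ A` with basis
elements of degrees `deg`. -/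
def freeGrading {K A ι : Type} [Field K] [CommRing A] [Algebra K A] [AddCommGroup ι]
    (𝒜 : ι → Submodule K A) {σ : Type} (deg : σ → ι) (j : ι) : Submodule K (σ →₀ A) where
  carrier := {f | ∀ s, f s ∈ 𝒜 (j - deg s)}
  add_mem' := fun {f g} hf hg s => by
    rw [Finsupp.add_apply]; exact add_mem (hf s) (hg s)
  zero_mem' := fun s => by simp
  smul_mem' := fun c f hf s => by
    rw [Finsupp.smul_apply]; exact Submodule.smul_mem _ c (hf s)

/-- A map of graded modules has degree `0`. -/
def IsGradedMap {K A ι M N : Type} [Field K] [CommRing A] [Algebra K A] [AddCommGroup ι]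
    [AddCommGroup M] [Module A M] [AddCommGroup N] [Module A N]
    [Module K M] [Module K N]
    (ℳ : ι → Submodule K M) (𝒩 : ι → Submodule K N) (φ : M →ₗ[A] N) : Prop :=
  ∀ j : ι, ∀ x ∈ ℳ j, φ x ∈ 𝒩 j

/-- A graded free resolution of the graded module `(M, ℳ)` over the graded algebra
`(A, 𝒜)`, in which the `s`-th free module has basis elements of degrees lying in
the prescribed set `D s`.  The existence of such a resolution with
`D s = {j | j ≤ b s}` is equivalent to the vanishing `Tor_s^A(M, K)_j = 0` for all
`j > b s`, i.e. to `t_s(M) ≤ b s` (for all `s` simultaneously). -/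
structure GradedFreeResolution (K A : Type) [Field K] [CommRing A] [Algebra K A]
    {ι : Type} [AddCommGroup ι] (𝒜 : ι → Submodule K A)
    (M : Type) [AddCommGroup M] [Module A M] [Module K M]
    (ℳ : ι → Submodule K M) (D : ℕ → Set ι) where
  σ : ℕ → Type
  deg : (s : ℕ) → σ s → ι
  deg_mem : ∀ (s : ℕ) (i : σ s), deg s i ∈ D s
  aug : (σ 0 →₀ A) →ₗ[A] M
  d : (s : ℕ) → ((σ (s+1) →₀ A) →ₗ[A] (σ s →₀ A))
  aug_surjective : Function.Surjective aug
  aug_graded : IsGradedMap (K := K) (freeGrading 𝒜 (deg 0)) ℳ aug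
  d_graded : ∀ s : ℕ,
    IsGradedMap (K := K) (freeGrading 𝒜 (deg (s+1))) (freeGrading 𝒜 (deg s)) (d s)
  exact_zero : LinearMap.range (d 0) = LinearMap.ker aug
  exact_succ : ∀ s : ℕ, LinearMap.range (d (s+1)) = LinearMap.ker (d s)

/-- The irrelevant ideal of a graded algebra. -/
def irrelevant {K B ι : Type} [Field K] [CommRing B] [Algebra K B] [AddCommGroup ι]
    (ℬ : ι → Submodule K B) : Ideal B :=
  Ideal.span {x | ∃ i : ι, i ≠ 0 ∧ x ∈ ℬ i}

/-- The grading of the residue field `B ⧸ B₊`, concentrated in degree `0`. -/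
def residueGrading (K B : Type) [Field K] [CommRing B] [Algebra K B] {ι : Type}
    [AddCommGroup ι] [DecidableEq ι] (ℬ : ι → Submodule K B) :
    ι → Submodule K (B ⧸ irrelevant ℬ) :=
  fun i => if i = 0 then ⊤ else ⊥

/-- A positively `ℤ`-graded `K`-algebra is Koszul if the residue field has a linear
graded free resolution. -/
def IsKoszul (K B : Type) [Field K] [CommRing B] [Algebra K B]
    (ℬ : ℤ → Submodule K B) : Prop :=
  Nonempty (GradedFreeResolution K B ℬ (B ⧸ irrelevant ℬ) (residueGrading K B ℬ)
    (fun s => {(s : ℤ)}))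

/-- A (positively) bigraded `K`-algebra is Koszul if the residue field has a free
resolution which is linear in the total degree. -/
def IsKoszulBi (K B : Type) [Field K] [CommRing B] [Algebra K B]
    (ℬ : ℤ × ℤ → Submodule K B) : Prop :=
  Nonempty (GradedFreeResolution K B ℬ (B ⧸ irrelevant ℬ) (residueGrading K B ℬ)
    (fun s => {v : ℤ × ℤ | v.1 + v.2 = (s : ℤ)}))

/-- A bigraded algebra is standard if it is positively graded and generated by its
components of degrees `(1,0)` and `(0,1)` over the degree-`(0,0)` part `K`. -/
def IsStandardBigraded (K R : Type) [Field K] [CommRing R] [Algebra K R]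
    (ℛ : ℤ × ℤ → Submodule K R) : Prop :=
  (∀ p : ℤ × ℤ, p.1 < 0 ∨ p.2 < 0 → ℛ p = ⊥) ∧
  (ℛ (0, 0) = 1) ∧
  (∀ p : ℤ × ℤ, 0 ≤ p.1 → 0 ≤ p.2 →
    ℛ p = ℛ (1, 0) ^ p.1.toNat * ℛ (0, 1) ^ p.2.toNat)

/-- A `ℤ`-graded `K`-algebra is standard if it is positively graded, `𝒜 0 = K`, and
it is generated in degree `1`. -/
def IsStandardGraded (K A : Type) [Field K] [CommRing A] [Algebra K A]
    (𝒜 : ℤ → Submodule K A) : Prop :=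
  (∀ i : ℤ, i < 0 → 𝒜 i = ⊥) ∧ (𝒜 0 = 1) ∧ (∀ n : ℕ, 𝒜 (n : ℤ) = 𝒜 1 ^ n)

/-- A grading of an `A`-module, presented by the projections onto its homogeneous components. -/
structure ComponentProjections {K A : Type} [Field K] [CommRing A] [Algebra K A]
    (𝒜 : ℤ → Submodule K A) [GradedAlgebra 𝒜] (M : Type) [AddCommGroup M] [Module A M] where
  proj : ℤ → M →+ M
  proj_proj_self : ∀ j x, proj j (proj j x) = proj j x
  proj_proj_of_ne : ∀ i j x, i ≠ j → proj i (proj j x) = 0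
  exists_sum_proj : ∀ x, ∃ s : Finset ℤ, ∑ j ∈ s, proj j x = x
  proj_smul : ∀ (b : A) (j d : ℤ) (x : M), proj d x = x →
    proj j (b • x) = GradedAlgebra.proj 𝒜 (j - d) b • x

namespace ComponentProjections

variable {K A : Type} [Field K] [CommRing A] [Algebra K A]
  {𝒜 : ℤ → Submodule K A} [GradedAlgebra 𝒜]

section General

variable {M N : Type} [AddCommGroup M] [Module A M] [AddCommGroup N] [Module A N]

theorem proj_eq_zero (P : ComponentProjections 𝒜 M) {i j : ℤ} {x : M} (hx : P.proj j x = x)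
    (hij : i ≠ j) : P.proj i x = 0 := by
  rw [← hx]; exact P.proj_proj_of_ne i j x hij

/-- The linear map `f` commutes with the projections onto homogeneous components. -/
def Commutes (P : ComponentProjections 𝒜 M) (Q : ComponentProjections 𝒜 N)
    (f : M →ₗ[A] N) : Prop :=
  ∀ j x, f (P.proj j x) = Q.proj j (f x)

theorem commutes_of_homogeneous {P : ComponentProjections 𝒜 M} {Q : ComponentProjections 𝒜 N}
    {f : M →ₗ[A] N} (hf : ∀ j x, P.proj j x = x → Q.proj j (f x) = f x) : P.Commutes Q f := by
  intro j x
  obtain ⟨s, hs⟩ := P.exists_sum_proj x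
  have key : ∀ i, Q.proj j (f (P.proj i x)) = f (P.proj j (P.proj i x)) := by
    intro i
    by_cases hij : j = i
    · subst hij
      rw [hf _ _ (P.proj_proj_self j x), P.proj_proj_self]
    · rw [Q.proj_eq_zero (hf _ _ (P.proj_proj_self i x)) hij, P.proj_proj_of_ne j i x hij, map_zero]
  conv_lhs => rw [← hs]
  conv_rhs => rw [← hs]
  simp only [map_sum, key]

/-- The grading of a module given by an internal direct sum decomposition. -/
noncomputable def ofIsInternal [Module K M] (ℳ : ℤ → Submodule K M)
    (hint : DirectSum.IsInternal ℳ)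
    (hsm : ∀ (i j : ℤ), ∀ x ∈ 𝒜 i, ∀ m ∈ ℳ j, x • m ∈ ℳ (i + j)) :
    ComponentProjections 𝒜 M :=
  letI : DirectSum.Decomposition ℳ := hint.chooseDecomposition
  { proj := fun j =>
      { toFun := fun x => (DirectSum.decompose ℳ x j : M)
        map_zero' := by simp
        map_add' := fun x y => by simp }
    proj_proj_self := fun j x =>
      DirectSum.decompose_of_mem_same ℳ (DirectSum.decompose ℳ x j).2
    proj_proj_of_ne := fun i j x hij =>
      DirectSum.decompose_of_mem_ne ℳ (DirectSum.decompose ℳ x j).2 hij.symm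
    exists_sum_proj := fun x => by
      classical
      exact ⟨_, DirectSum.sum_support_decompose ℳ x⟩
    proj_smul := fun b j d x hx => by
      have hxd : x ∈ ℳ d := by
        have := (DirectSum.decompose ℳ x d).2
        rwa [show (DirectSum.decompose ℳ x d : M) = x from hx] at this
      change (DirectSum.decompose ℳ (b • x) j : M) = GradedAlgebra.proj 𝒜 (j - d) b • x
      induction b using DirectSum.Decomposition.inductionOn 𝒜 with
      | zero => simp
      | @homogeneous i m =>
        have hm : (m : A) • x ∈ ℳ (i + d) := hsm i d m m.2 x hxd
        rw [GradedAlgebra.proj_apply]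
        by_cases hij : i = j - d
        · subst hij
          rw [sub_add_cancel] at hm
          rw [DirectSum.decompose_of_mem_same 𝒜 m.2, DirectSum.decompose_of_mem_same ℳ hm]
        · rw [DirectSum.decompose_of_mem_ne 𝒜 m.2 hij, zero_smul,
            DirectSum.decompose_of_mem_ne ℳ hm (fun h => hij (by omega))]
      | add m m' h h' =>
        rw [add_smul, DirectSum.decompose_add, map_add, add_smul, ← h, ← h']
        rfl }

theorem ofIsInternal_proj_eq_iff [Module K M] {ℳ : ℤ → Submodule K M}
    (hint : DirectSum.IsInternal ℳ)
    (hsm : ∀ (i j : ℤ), ∀ x ∈ 𝒜 i, ∀ m ∈ ℳ j, x • m ∈ ℳ (i + j)) (j : ℤ) (x : M) :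
    (ofIsInternal ℳ hint hsm).proj j x = x ↔ x ∈ ℳ j := by
  let : DirectSum.Decomposition ℳ := hint.chooseDecomposition
  change (DirectSum.decompose ℳ x j : M) = x ↔ x ∈ ℳ j
  refine ⟨fun h => ?_, fun h => DirectSum.decompose_of_mem_same ℳ h⟩
  rw [← h]
  exact (DirectSum.decompose ℳ x j).2

/-- The grading of the kernel of a graded map. -/
def ker (P : ComponentProjections 𝒜 M) (Q : ComponentProjections 𝒜 N) (f : M →ₗ[A] N)
    (hf : P.Commutes Q f) : ComponentProjections 𝒜 (LinearMap.ker f) where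
  proj j :=
    { toFun := fun x => ⟨P.proj j x, by rw [LinearMap.mem_ker, hf, x.2, map_zero]⟩
      map_zero' := by ext; simp
      map_add' := fun x y => by ext; simp }
  proj_proj_self j x := Subtype.ext (P.proj_proj_self j x)
  proj_proj_of_ne i j x hij := Subtype.ext (P.proj_proj_of_ne i j x hij)
  exists_sum_proj x := by
    obtain ⟨s, hs⟩ := P.exists_sum_proj x
    refine ⟨s, Subtype.ext ?_⟩
    rw [AddSubmonoidClass.coe_finsetSum]
    exact hs
  proj_smul b j d x hx := Subtype.ext (P.proj_smul b j d x (congrArg Subtype.val hx))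

end General

section Free

variable {σ : Type}

variable (𝒜) in
/-- The grading of the free module with basis elements of prescribed degrees. -/
noncomputable def free (deg : σ → ℤ) : ComponentProjections 𝒜 (σ →₀ A) where
  proj j :=
    { toFun := fun c => Finsupp.onFinset c.support
        (fun s => GradedAlgebra.proj 𝒜 (j - deg s) (c s))
        (fun s hs => by
          rw [Finsupp.mem_support_iff]
          intro h0
          exact hs (by rw [h0, map_zero]))
      map_zero' := by ext; simp
      map_add' := fun x y => by ext; simp }
  proj_proj_self j x := by
    ext s
    exact DirectSum.decompose_of_mem_same 𝒜 (DirectSum.decompose 𝒜 (x s) (j - deg s)).2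
  proj_proj_of_ne i j x hij := by
    ext s
    exact DirectSum.decompose_of_mem_ne 𝒜 (DirectSum.decompose 𝒜 (x s) (j - deg s)).2
      (fun h => hij (by omega))
  exists_sum_proj x := by
    classical
    refine ⟨x.support.biUnion fun s =>
      (DirectSum.decompose 𝒜 (x s)).support.image fun i => i + deg s, ?_⟩
    ext s
    rw [Finsupp.finsetSum_apply]
    change ∑ j ∈ _, (DirectSum.decompose 𝒜 (x s) (j - deg s) : A) = x s
    by_cases hs : x s = 0
    · simp [hs]
    · refine (Finset.sum_subset (Finset.subset_biUnion_of_mem (fun s =>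
        (DirectSum.decompose 𝒜 (x s)).support.image fun i => i + deg s)
        (Finsupp.mem_support_iff.2 hs)) fun j _ hj => ?_).symm.trans ?_
      · by_contra h0
        exact hj (Finset.mem_image.2 ⟨j - deg s, DFinsupp.mem_support_iff.2
          fun h => h0 (by rw [h]; rfl), sub_add_cancel _ _⟩)
      · rw [Finset.sum_image fun i _ i' _ h => add_right_cancel h]
        exact (Finset.sum_congr rfl fun i _ => by rw [add_sub_cancel_right]).trans
          (DirectSum.sum_support_decompose 𝒜 (x s))
  proj_smul b j d x hx := by
    ext s
    have hxs : x s ∈ 𝒜 (d - deg s) := by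
      rw [← hx]
      exact (DirectSum.decompose 𝒜 (x s) (d - deg s)).2
    change (DirectSum.decompose 𝒜 (b * x s) (j - deg s) : A)
      = (DirectSum.decompose 𝒜 b (j - d) : A) * x s
    rw [← DirectSum.coe_decompose_mul_add_of_right_mem 𝒜 hxs, sub_add_sub_cancel]

theorem free_proj_apply (deg : σ → ℤ) (j : ℤ) (c : σ →₀ A) (s : σ) :
    (free 𝒜 deg).proj j c s = GradedAlgebra.proj 𝒜 (j - deg s) (c s) := rfl

theorem free_proj_eq_iff (deg : σ → ℤ) (j : ℤ) (c : σ →₀ A) :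
    (free 𝒜 deg).proj j c = c ↔ c ∈ freeGrading 𝒜 deg j := by
  refine ⟨fun h s => ?_, fun h => ?_⟩
  · rw [← h]
    exact (DirectSum.decompose 𝒜 (c s) (j - deg s)).2
  · ext s
    exact DirectSum.decompose_of_mem_same 𝒜 (h s)

theorem free_proj_single (deg : σ → ℤ) (s : σ) :
    (free 𝒜 deg).proj (deg s) (Finsupp.single s 1) = Finsupp.single s 1 := by
  classical
  rw [free_proj_eq_iff]
  intro t
  rw [Finsupp.single_apply]
  split_ifs with h
  · subst h
    rw [sub_self]
    exact SetLike.GradedOne.one_mem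
  · exact zero_mem _

variable {M : Type} [AddCommGroup M] [Module A M]

theorem commutes_linearCombination (P : ComponentProjections 𝒜 M) (deg : σ → ℤ) (b : σ → M)
    (hb : ∀ s, P.proj (deg s) (b s) = b s) :
    (free 𝒜 deg).Commutes P (Finsupp.linearCombination A b) := by
  refine commutes_of_homogeneous fun j c hc => ?_
  rw [Finsupp.linearCombination_apply, Finsupp.sum, map_sum]
  refine Finset.sum_congr rfl fun s _ => ?_
  rw [P.proj_smul _ _ _ _ (hb s), ← free_proj_apply, hc]

end Free

/-- A graded surjection from a graded free module. -/
structure FreeCover {M : Type} [AddCommGroup M] [Module A M]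
    (P : ComponentProjections 𝒜 M) where
  σ : Type
  deg : σ → ℤ
  map : (σ →₀ A) →ₗ[A] M
  surjective : Function.Surjective map
  commutes : (free 𝒜 deg).Commutes P map

namespace FreeCover

variable {M : Type} [AddCommGroup M] [Module A M] {P : ComponentProjections 𝒜 M}

/-- The grading of the kernel of a graded free cover. -/
noncomputable def kerProj (C : FreeCover P) : ComponentProjections 𝒜 (LinearMap.ker C.map) :=
  (free 𝒜 C.deg).ker P C.map C.commutes

/-- The free cover with one basis element for each homogeneous element. -/
noncomputable def canonical (P : ComponentProjections 𝒜 M) : FreeCover P where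
  σ := {v : ℤ × M // P.proj v.1 v.2 = v.2}
  deg v := v.1.1
  map := Finsupp.linearCombination A fun v => v.1.2
  surjective := by
    intro x
    obtain ⟨s, hs⟩ := P.exists_sum_proj x
    refine ⟨∑ j ∈ s, Finsupp.single ⟨(j, P.proj j x), P.proj_proj_self j x⟩ 1, ?_⟩
    simp [map_sum, hs]
  commutes := commutes_linearCombination P _ _ fun v => v.2

end FreeCover

/-- The module has a graded free resolution whose `s`-th term is generated in degrees at most
`a + s` for all `s < n`. -/
def LinearlyBounded : ℕ → ℤ → {M : Type} → [AddCommGroup M] → [Module A M] →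
    ComponentProjections 𝒜 M → Prop
  | 0, _, _, _, _, _ => True
  | n + 1, a, _, _, _, P =>
    ∃ C : FreeCover P, (∀ i, C.deg i ≤ a) ∧ LinearlyBounded n (a + 1) C.kerProj

/-- The horseshoe lemma. -/
theorem LinearlyBounded.of_extension (n : ℕ) : ∀ (a : ℤ) {X Y Z : Type} [AddCommGroup X]
    [Module A X] [AddCommGroup Y] [Module A Y] [AddCommGroup Z] [Module A Z]
    (PX : ComponentProjections 𝒜 X) (PY : ComponentProjections 𝒜 Y)
    (PZ : ComponentProjections 𝒜 Z) (i : X →ₗ[A] Y) (q : Y →ₗ[A] Z),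
    PX.Commutes PY i → PY.Commutes PZ q → Function.Injective i →
    LinearMap.range i = LinearMap.ker q → Function.Surjective q →
    LinearlyBounded n a PX → LinearlyBounded n a PZ → LinearlyBounded n a PY := by
  induction n with
  | zero => intros; trivial
  | succ n ih =>
    intro a X Y Z _ _ _ _ _ _ PX PY PZ i q hi hq hinj hex hsurj ⟨CX, hCX, hX⟩ ⟨CZ, hCZ, hZ⟩
    have hqi : ∀ x, q (i x) = 0 := fun x => by
      have : i x ∈ LinearMap.ker q := hex ▸ LinearMap.mem_range_self i x
      exact this
    have hlift : ∀ s : CZ.σ, ∃ y, PY.proj (CZ.deg s) y = y ∧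
        q y = CZ.map (Finsupp.single s 1) := by
      intro s
      obtain ⟨y, hy⟩ := hsurj (CZ.map (Finsupp.single s 1))
      refine ⟨PY.proj (CZ.deg s) y, PY.proj_proj_self _ _, ?_⟩
      rw [hq, hy, ← CZ.commutes, free_proj_single]
    choose y hy hqy using hlift
    let deg : CX.σ ⊕ CZ.σ → ℤ := Sum.elim CX.deg CZ.deg
    let b : CX.σ ⊕ CZ.σ → Y := Sum.elim (fun s => i (CX.map (Finsupp.single s 1))) y
    have hb : ∀ s, PY.proj (deg s) (b s) = b s := by
      rintro (s | s)
      · change PY.proj (CX.deg s) (i (CX.map (Finsupp.single s 1))) = _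
        rw [← hi, ← CX.commutes, free_proj_single]
        rfl
      · exact hy s
    let g := Finsupp.linearCombination A b
    let inl : (CX.σ →₀ A) →ₗ[A] (CX.σ ⊕ CZ.σ →₀ A) := Finsupp.lmapDomain A A Sum.inl
    let inr : (CZ.σ →₀ A) →ₗ[A] (CX.σ ⊕ CZ.σ →₀ A) := Finsupp.lmapDomain A A Sum.inr
    let snd : (CX.σ ⊕ CZ.σ →₀ A) →ₗ[A] (CZ.σ →₀ A) :=
      Finsupp.lcomapDomain Sum.inr Sum.inr_injective
    have hsnd : ∀ c s, snd c s = c (Sum.inr s) := fun c s => rfl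
    have inl_inl : ∀ c s, inl c (Sum.inl s) = c s := fun c s =>
      Finsupp.mapDomain_apply Sum.inl_injective c s
    have inl_inr : ∀ c s, inl c (Sum.inr s) = 0 := fun c s =>
      Finsupp.mapDomain_of_notMem_range c _ (by simp)
    have inr_inr : ∀ c s, inr c (Sum.inr s) = c s := fun c s =>
      Finsupp.mapDomain_apply Sum.inr_injective c s
    have hginl : ∀ c, g (inl c) = i (CX.map c) := by
      intro c
      refine LinearMap.congr_fun (f := g ∘ₗ inl) (g := i ∘ₗ CX.map) ?_ c
      ext s
      simp [g, inl, b, Finsupp.lmapDomain_apply]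
    have hsndinr : ∀ c, snd (inr c) = c := fun c => by ext s; rw [hsnd, inr_inr]
    have hsndinl : ∀ c, snd (inl c) = 0 := fun c => by ext s; rw [hsnd, inl_inr]; rfl
    have hqg : ∀ c, q (g c) = CZ.map (snd c) := by
      intro c
      refine LinearMap.congr_fun (f := q ∘ₗ g) (g := CZ.map ∘ₗ snd) ?_ c
      ext s
      rcases s with s | s
      · have : snd (Finsupp.single (Sum.inl s) 1) = 0 := by
          ext t; rw [hsnd]; simp
        simp [g, b, this, hqi]
      · have : snd (Finsupp.single (Sum.inr s) 1) = Finsupp.single s 1 := by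
          classical
          ext t; rw [hsnd]; simp [Finsupp.single_apply]
        simp [g, b, this, hqy]
    have hsub : ∀ c, snd c = 0 → ∃ c', inl c' = c := by
      intro c hc
      refine ⟨Finsupp.comapDomain Sum.inl c Sum.inl_injective.injOn, ?_⟩
      ext s
      rcases s with s | s
      · rw [inl_inl]; rfl
      · rw [inl_inr, ← hsnd, hc]; rfl
    have hgsurj : Function.Surjective g := by
      intro v
      obtain ⟨c, hc⟩ := CZ.surjective (q v)
      have : v - g (inr c) ∈ LinearMap.range i := by
        rw [hex, LinearMap.mem_ker, map_sub, hqg, hsndinr, hc, sub_self]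
      obtain ⟨x, hx⟩ := this
      obtain ⟨c', rfl⟩ := CX.surjective x
      exact ⟨inl c' + inr c, by rw [map_add, hginl, hx, sub_add_cancel]⟩
    let C : FreeCover PY := ⟨_, deg, g, hgsurj, commutes_linearCombination PY deg b hb⟩
    refine ⟨C, by rintro (s | s); exacts [hCX s, hCZ s], ?_⟩
    have hg0 : ∀ c, g (inl c) = 0 ↔ CX.map c = 0 := fun c => by
      rw [hginl, map_eq_zero_iff i hinj]
    refine ih (a + 1) CX.kerProj C.kerProj CZ.kerProj
      (inl.restrict fun c hc => (hg0 c).2 hc)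
      (snd.restrict fun c hc => by
        rw [LinearMap.mem_ker, ← hqg, show g c = 0 from hc, map_zero]) ?_ ?_ ?_ ?_ ?_ hX hZ
    · intro j x
      refine Subtype.ext (Finsupp.ext ?_)
      rintro (s | s)
      · change inl ((free 𝒜 CX.deg).proj j x) (Sum.inl s)
          = GradedAlgebra.proj 𝒜 (j - CX.deg s) (inl x (Sum.inl s))
        rw [inl_inl, inl_inl]; rfl
      · change inl ((free 𝒜 CX.deg).proj j x) (Sum.inr s)
          = GradedAlgebra.proj 𝒜 (j - CZ.deg s) (inl x (Sum.inr s))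
        rw [inl_inr, inl_inr, map_zero]
    · intro j x
      refine Subtype.ext (Finsupp.ext fun s => ?_)
      rfl
    · intro x x' h
      exact Subtype.ext (Finsupp.mapDomain_injective Sum.inl_injective (congrArg Subtype.val h))
    · ext ⟨c, hc⟩
      rw [LinearMap.mem_range, LinearMap.mem_ker]
      constructor
      · rintro ⟨x, hx⟩
        rw [← hx]
        exact Subtype.ext (hsndinl x)
      · intro h
        obtain ⟨c', rfl⟩ := hsub c (congrArg Subtype.val h)
        exact ⟨⟨c', (hg0 c').1 hc⟩, rfl⟩
    · rintro ⟨z, hz⟩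
      have : g (inr z) ∈ LinearMap.range i := by
        rw [hex, LinearMap.mem_ker, hqg, hsndinr]; exact hz
      obtain ⟨x, hx⟩ := this
      obtain ⟨c', rfl⟩ := CX.surjective x
      have hmem : g (inr z - inl c') = 0 := by rw [map_sub, hginl, hx, sub_self]
      refine ⟨⟨inr z - inl c', hmem⟩, Subtype.ext ?_⟩
      change snd (inr z - inl c') = z
      rw [map_sub, hsndinr, hsndinl, sub_zero]

theorem LinearlyBounded.of_surjective {n : ℕ} {a : ℤ} {M N : Type} [AddCommGroup M]
    [Module A M] [AddCommGroup N] [Module A N] {P : ComponentProjections 𝒜 M}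
    {Q : ComponentProjections 𝒜 N} (q : N →ₗ[A] M) (hq : Q.Commutes P q)
    (hsurj : Function.Surjective q) (hN : LinearlyBounded (n + 1) a Q)
    (hker : LinearlyBounded n (a + 1) (Q.ker P q hq)) : LinearlyBounded (n + 1) a P := by
  obtain ⟨C, hC, hCker⟩ := hN
  let C' : FreeCover P := ⟨C.σ, C.deg, q ∘ₗ C.map, hsurj.comp C.surjective, fun j x => by
    rw [LinearMap.comp_apply, C.commutes, hq, LinearMap.comp_apply]⟩
  refine ⟨C', hC, ?_⟩
  refine LinearlyBounded.of_extension n (a + 1) C.kerProj C'.kerProj (Q.ker P q hq)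
    (Submodule.inclusion (LinearMap.ker_le_ker_comp C.map q))
    (C.map.restrict fun c hc => hc) (fun j x => rfl)
    (fun j x => Subtype.ext (C.commutes j x)) (Submodule.inclusion_injective _) ?_ ?_ hCker hker
  · ext ⟨c, hc⟩
    rw [LinearMap.mem_range, LinearMap.mem_ker]
    constructor
    · rintro ⟨x, hx⟩
      rw [← hx]
      exact Subtype.ext x.2
    · intro h
      exact ⟨⟨c, congrArg Subtype.val h⟩, rfl⟩
  · rintro ⟨y, hy⟩
    obtain ⟨c, rfl⟩ := C.surjective y
    exact ⟨⟨c, hy⟩, rfl⟩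

theorem LinearlyBounded.of_exact_complex (n : ℕ) : ∀ (a : ℤ) {M : Type} [AddCommGroup M]
    [Module A M] (P : ComponentProjections 𝒜 M) (N : ℕ → Type) [∀ r, AddCommGroup (N r)]
    [∀ r, Module A (N r)] (Q : ∀ r, ComponentProjections 𝒜 (N r))
    (φ : ∀ r, N (r + 1) →ₗ[A] N r) (π : N 0 →ₗ[A] M), (Q 0).Commutes P π →
    (∀ r, (Q (r + 1)).Commutes (Q r) (φ r)) → Function.Surjective π →
    LinearMap.range (φ 0) = LinearMap.ker π →
    (∀ r, LinearMap.range (φ (r + 1)) = LinearMap.ker (φ r)) →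
    (∀ r < n, LinearlyBounded (n - r) (a + r) (Q r)) → LinearlyBounded n a P := by
  induction n with
  | zero => intros; trivial
  | succ n ih =>
    intro a M _ _ P N _ _ Q φ π hπ hφ hsurj hex0 hex hb
    have hb0 := hb 0 n.succ_pos
    rw [Nat.sub_zero, Nat.cast_zero, add_zero] at hb0
    refine LinearlyBounded.of_surjective π hπ hsurj hb0 ?_
    refine ih (a + 1) _ (fun r => N (r + 1)) (fun r => Q (r + 1)) (fun r => φ (r + 1))
      ((φ 0).codRestrict (LinearMap.ker π) fun c => hex0 ▸ LinearMap.mem_range_self (φ 0) c)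
      (fun j x => Subtype.ext (hφ 0 j x)) (fun r => hφ (r + 1)) ?_ ?_ (fun r => hex (r + 1)) ?_
    · rintro ⟨x, hx⟩
      rw [← hex0] at hx
      obtain ⟨c, rfl⟩ := hx
      exact ⟨c, rfl⟩
    · rw [LinearMap.ker_codRestrict]
      exact hex 0
    · intro r hr
      have := hb (r + 1) (by omega)
      rwa [Nat.add_sub_add_right, Nat.cast_succ, add_comm (r : ℤ), ← add_assoc] at this

theorem LinearlyBounded.of_resolution (n : ℕ) : ∀ (a : ℤ) {M : Type} [AddCommGroup M]
    [Module A M] (P : ComponentProjections 𝒜 M) (σ : ℕ → Type) (deg : ∀ s, σ s → ℤ)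
    (aug : (σ 0 →₀ A) →ₗ[A] M) (d : ∀ s, (σ (s + 1) →₀ A) →ₗ[A] (σ s →₀ A)),
    (ComponentProjections.free 𝒜 (deg 0)).Commutes P aug →
    (∀ s, (ComponentProjections.free 𝒜 (deg (s + 1))).Commutes
      (ComponentProjections.free 𝒜 (deg s)) (d s)) →
    Function.Surjective aug →
    LinearMap.range (d 0) = LinearMap.ker aug →
    (∀ s, LinearMap.range (d (s + 1)) = LinearMap.ker (d s)) →
    (∀ s < n, ∀ i, deg s i ≤ a + s) → LinearlyBounded n a P := by
  induction n with
  | zero => intros; trivial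
  | succ n ih =>
    intro a M _ _ P σ deg aug d haug hd hsurj hex0 hex hb
    refine ⟨⟨σ 0, deg 0, aug, hsurj, haug⟩, fun i => by simpa using hb 0 n.succ_pos i, ?_⟩
    refine ih (a + 1) _ (fun s => σ (s + 1)) (fun s => deg (s + 1))
      ((d 0).codRestrict (LinearMap.ker aug) fun c => hex0 ▸ LinearMap.mem_range_self (d 0) c)
      (fun s => d (s + 1)) (fun j x => Subtype.ext (hd 0 j x)) (fun s => hd (s + 1)) ?_ ?_
      (fun s => hex (s + 1)) ?_
    · rintro ⟨x, hx⟩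
      rw [← hex0] at hx
      obtain ⟨c, rfl⟩ := hx
      exact ⟨c, rfl⟩
    · rw [LinearMap.ker_codRestrict]
      exact hex 0
    · intro s hs i
      have := hb (s + 1) (by omega) i
      push_cast at this
      linarith

variable (𝒜) in
/-- A graded module together with a bound on the degrees of the generators in the first `n`
steps of some graded free resolution. -/
structure BoundedModule where
  M : Type
  [addCommGroup : AddCommGroup M]
  [module : Module A M]
  P : ComponentProjections 𝒜 M
  n : ℕ
  a : ℤ
  bounded : LinearlyBounded n a P

namespace BoundedModule

attribute [instance] addCommGroup module

theorem exists_cover (X : BoundedModule 𝒜) : ∃ C : FreeCover X.P,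
    (0 < X.n → ∀ i, C.deg i ≤ X.a) ∧ LinearlyBounded (X.n - 1) (X.a + 1) C.kerProj := by
  obtain ⟨M, P, n, a, hb⟩ := X
  cases n with
  | zero => exact ⟨FreeCover.canonical P, fun h => absurd h (lt_irrefl 0), trivial⟩
  | succ n =>
    obtain ⟨C, hC, hker⟩ := hb
    exact ⟨C, fun _ => hC, hker⟩

/-- A free cover satisfying the degree bound. -/
noncomputable def cover (X : BoundedModule 𝒜) : FreeCover X.P := X.exists_cover.choose

/-- The first syzygy module. -/
noncomputable def syzygy (X : BoundedModule 𝒜) : BoundedModule 𝒜 where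
  M := LinearMap.ker X.cover.map
  P := X.cover.kerProj
  n := X.n - 1
  a := X.a + 1
  bounded := X.exists_cover.choose_spec.2

/-- The iterated syzygy modules. -/
noncomputable def syzygies (X : BoundedModule 𝒜) : ℕ → BoundedModule 𝒜
  | 0 => X
  | s + 1 => (syzygies X s).syzygy

theorem syzygies_n_a (X : BoundedModule 𝒜) (s : ℕ) :
    (X.syzygies s).n = X.n - s ∧ (X.syzygies s).a = X.a + s := by
  induction s with
  | zero => simp [syzygies]
  | succ s ih =>
    refine ⟨?_, ?_⟩
    · change (X.syzygies s).n - 1 = _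
      rw [ih.1]; omega
    · change (X.syzygies s).a + 1 = _
      rw [ih.2]; push_cast; ring

theorem deg_le (X : BoundedModule 𝒜) {s : ℕ} (hs : s < X.n) (i) :
    (X.syzygies s).cover.deg i ≤ X.a + s := by
  have h := (X.syzygies_n_a s)
  rw [← h.2]
  exact (X.syzygies s).exists_cover.choose_spec.1 (by rw [h.1]; omega) i

/-- The differential of the resolution assembled from the covers of the iterated syzygies. -/
noncomputable def differential (X : BoundedModule 𝒜) (s : ℕ) :
    ((X.syzygies (s + 1)).cover.σ →₀ A) →ₗ[A] ((X.syzygies s).cover.σ →₀ A) :=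
  (LinearMap.ker (X.syzygies s).cover.map).subtype ∘ₗ (X.syzygies (s + 1)).cover.map

theorem range_differential (X : BoundedModule 𝒜) (s : ℕ) :
    LinearMap.range (X.differential s) = LinearMap.ker (X.syzygies s).cover.map := by
  refine (LinearMap.range_comp_of_range_eq_top _
    (LinearMap.range_eq_top.2 (X.syzygies (s + 1)).cover.surjective)).trans ?_
  exact Submodule.range_subtype _

theorem ker_differential (X : BoundedModule 𝒜) (s : ℕ) :
    LinearMap.ker (X.differential s) = LinearMap.ker (X.syzygies (s + 1)).cover.map :=
  LinearMap.ker_comp_of_ker_eq_bot _ (Submodule.ker_subtype _)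

theorem differential_commutes (X : BoundedModule 𝒜) (s : ℕ) :
    (free 𝒜 (X.syzygies (s + 1)).cover.deg).Commutes (free 𝒜 (X.syzygies s).cover.deg)
      (X.differential s) := fun j x =>
  congrArg Subtype.val ((X.syzygies (s + 1)).cover.commutes j x)

end BoundedModule

end ComponentProjections

/-- **Lemma.**  Let `A` be a standard graded `K`-algebra, `M` a finitely generated
graded `A`-module and `⋯ → N_r → ⋯ → N_1 → N_0 → M → 0` an exact complex of finitely
generated graded `A`-modules.  Let `h ∈ ℕ` and `a ∈ ℤ` be such that
`t_s(N_r) ≤ a + r + s` for all `0 ≤ r ≤ h` and `0 ≤ s ≤ h - r`.  Then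
`t_h(M) ≤ a + h`.  Here the bound `t_s(N) ≤ b_s` (simultaneously in `s`) is encoded,
equivalently, as the existence of a graded free resolution whose `s`-th free module
has generators in degrees `≤ b_s`. -/
theorem t_bound_of_exact_complex
    (K A : Type) [Field K] [CommRing A] [Algebra K A]
    (𝒜 : ℤ → Submodule K A) [GradedAlgebra 𝒜]
    (hstd : IsStandardGraded K A 𝒜)
    -- the graded module M
    (M : Type) [AddCommGroup M] [Module A M] [Module K M] [IsScalarTower K A M]
    (ℳ : ℤ → Submodule K M) (hMint : DirectSum.IsInternal ℳ)
    (hMsm : ∀ (i j : ℤ), ∀ x ∈ 𝒜 i, ∀ m ∈ ℳ j, x • m ∈ ℳ (i + j))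
    (hMfin : Module.Finite A M)
    -- the graded modules N r
    (N : ℕ → Type) [∀ r, AddCommGroup (N r)] [∀ r, Module A (N r)]
    [∀ r, Module K (N r)] [∀ r, IsScalarTower K A (N r)]
    (𝒩 : (r : ℕ) → ℤ → Submodule K (N r))
    (hNint : ∀ r, DirectSum.IsInternal (𝒩 r))
    (hNsm : ∀ r, ∀ (i j : ℤ), ∀ x ∈ 𝒜 i, ∀ m ∈ 𝒩 r j, x • m ∈ 𝒩 r (i + j))
    (hNfin : ∀ r, Module.Finite A (N r))
    -- the exact complex  ⋯ → N_1 → N_0 → M → 0  with degree-0 maps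
    (φ : (r : ℕ) → (N (r + 1) →ₗ[A] N r)) (π : N 0 →ₗ[A] M)
    (hπgr : IsGradedMap (K := K) (𝒩 0) ℳ π)
    (hφgr : ∀ r, IsGradedMap (K := K) (𝒩 (r + 1)) (𝒩 r) (φ r))
    (hπsurj : Function.Surjective π)
    (hexact0 : LinearMap.range (φ 0) = LinearMap.ker π)
    (hexact : ∀ r, LinearMap.range (φ (r + 1)) = LinearMap.ker (φ r))
    -- the degree bounds  t_s(N_r) ≤ a + r + s  for r ≤ h, s ≤ h - r
    (h : ℕ) (a : ℤ)
    (hbound : ∀ r : ℕ, r ≤ h →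
      Nonempty (GradedFreeResolution K A 𝒜 (N r) (𝒩 r)
        (fun s => if s ≤ h - r then {j : ℤ | j ≤ a + r + s} else Set.univ))) :
    -- conclusion:  t_h(M) ≤ a + h
    Nonempty (GradedFreeResolution K A 𝒜 M ℳ
      (fun s => if s = h then {j : ℤ | j ≤ a + h} else Set.univ)) := by
  let P := ComponentProjections.ofIsInternal ℳ hMint hMsm
  let Q := fun r => ComponentProjections.ofIsInternal (𝒩 r) (hNint r) (hNsm r)
  have hP := ComponentProjections.ofIsInternal_proj_eq_iff hMint hMsm
  have hQ := fun r => ComponentProjections.ofIsInternal_proj_eq_iff (hNint r) (hNsm r)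
  have hM : ComponentProjections.LinearlyBounded (h + 1) a P := by
    refine ComponentProjections.LinearlyBounded.of_exact_complex (h + 1) a P N Q φ π
      (ComponentProjections.commutes_of_homogeneous fun j x hx =>
        (hP j _).2 (hπgr j x ((hQ 0 j x).1 hx)))
      (fun r => ComponentProjections.commutes_of_homogeneous fun j x hx =>
        (hQ r j _).2 (hφgr r j x ((hQ (r + 1) j x).1 hx)))
      hπsurj hexact0 hexact fun r hr => ?_
    obtain ⟨F⟩ := hbound r (by omega)
    refine ComponentProjections.LinearlyBounded.of_resolution (h + 1 - r) (a + r) (Q r) F.σ F.deg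
      F.aug F.d
      (ComponentProjections.commutes_of_homogeneous fun j x hx =>
        (hQ r j _).2 (F.aug_graded j x ((ComponentProjections.free_proj_eq_iff _ j x).1 hx)))
      (fun s => ComponentProjections.commutes_of_homogeneous fun j x hx =>
        (ComponentProjections.free_proj_eq_iff _ j _).2
          (F.d_graded s j x ((ComponentProjections.free_proj_eq_iff _ j x).1 hx)))
      F.aug_surjective F.exact_zero F.exact_succ fun s hs i => ?_
    have := F.deg_mem s i
    rwa [if_pos (show s ≤ h - r by omega)] at this
  let X : ComponentProjections.BoundedModule 𝒜 := ⟨M, P, h + 1, a, hM⟩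
  exact ⟨{
    σ := fun s => (X.syzygies s).cover.σ
    deg := fun s => (X.syzygies s).cover.deg
    deg_mem := fun s i => by
      split_ifs with hs
      · subst hs
        exact X.deg_le (Nat.lt_succ_self s) i
      · trivial
    aug := X.cover.map
    d := X.differential
    aug_surjective := X.cover.surjective
    aug_graded := fun j x hx => (hP j _).1 <| by
      rw [← ComponentProjections.free_proj_eq_iff] at hx
      exact (X.cover.commutes j x).symm.trans (congrArg X.cover.map hx)
    d_graded := fun s j x hx => by
      rw [← ComponentProjections.free_proj_eq_iff] at hx ⊢
      rw [← X.differential_commutes s, hx]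
    exact_zero := X.range_differential 0
    exact_succ := fun s => (X.range_differential (s + 1)).trans (X.ker_differential s).symm }⟩
end

section
/- Let R be a standard bigraded Koszul K-algebra and let n_y = (y_1,...,y_m) ⊂ R be the ideal generated by the residue classes of the y-variables. Then n_y has a bigraded 1-linear free R-resolution, i.e., Tor_i^R(n_y, K)_{(j,k)} = 0 for all i ≥ 0 and all (j,k) with j + k ≠ i + 1. -/
/-- The bigraded components of an ideal `I` of the bigraded algebra `R`, viewed as a
bigraded `R`-module: the `v`-th component consists of the elements of `I` of
bidegree `v`. -/
def idealComponent {K R : Type} [Field K] [CommRing R] [Algebra K R]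
    (ℛ : ℤ × ℤ → Submodule K R) (I : Ideal R) (v : ℤ × ℤ) : Submodule K ↥I where
  carrier := {x | (x : R) ∈ ℛ v}
  add_mem' := fun {x y} hx hy => by simpa using add_mem hx hy
  zero_mem' := by simp
  smul_mem' := fun c x hx => by simpa using Submodule.smul_mem (ℛ v) c hx

open scoped TensorProduct

/-- If `P` is projective and `f : P → N` takes values in the range of `g`, then `f` factors
through `g`. -/
theorem exists_lift_of_range_le {A P M N : Type} [CommRing A] [AddCommGroup P] [Module A P]
    [AddCommGroup M] [Module A M] [AddCommGroup N] [Module A N] [Module.Projective A P]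
    (f : P →ₗ[A] N) (g : M →ₗ[A] N) (h : ∀ x, f x ∈ LinearMap.range g) :
    ∃ k : P →ₗ[A] M, ∀ x, g (k x) = f x := by
  obtain ⟨k, hk⟩ := Module.projective_lifting_property g.rangeRestrict
    (f.codRestrict (LinearMap.range g) h) g.surjective_rangeRestrict
  exact ⟨k, fun x => congrArg Subtype.val (LinearMap.congr_fun hk x)⟩

/-- Linear maps send `I • ⊤` into `I • ⊤`. -/
theorem map_mem_smul_top {R M N : Type} [CommRing R] [AddCommGroup M] [Module R M]
    [AddCommGroup N] [Module R N] {I : Ideal R} (f : M →ₗ[R] N) {x : M}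
    (hx : x ∈ I • (⊤ : Submodule R M)) : f x ∈ I • (⊤ : Submodule R N) := by
  have := Submodule.mem_map_of_mem (f := f) hx
  rw [Submodule.map_smul''] at this
  exact Submodule.smul_mono le_rfl le_top this

section Detection

variable {R A : Type} [CommRing R] [CommRing A] [Algebra A R] (𝔪 : Ideal R)
  (F : ℕ → Type) [∀ n, AddCommGroup (F n)] [∀ n, Module R (F n)] [∀ n, Module A (F n)]
  [∀ n, IsScalarTower A R (F n)] (d : ∀ n, F (n + 1) →ₗ[R] F n)

variable (A) in
/-- There is an `A`-linear chain map from a complex of projective `A`-modules to `F ⊗ M` such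
that every cycle of `F ⊗ M` with coefficients in `𝔪` is homologous to the image of a cycle
with coefficients in the contraction of `𝔪` to `A`. -/
def Detects (M : Type) [AddCommGroup M] [Module R M] : Prop :=
  ∃ (Y : ℕ → Type) (_ : ∀ n, AddCommGroup (Y n)) (_ : ∀ n, Module A (Y n))
    (dY : ∀ n, Y (n + 1) →ₗ[A] Y n) (δ : ∀ n, Y n →ₗ[A] F n ⊗[R] M),
    (∀ n, Module.Projective A (Y n)) ∧
    (∀ n x, dY n (dY (n + 1) x) = 0) ∧
    (∀ n x, (d n).rTensor M (δ (n + 1) x) = δ n (dY n x)) ∧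
    ∀ n, ∀ c ∈ 𝔪 • (⊤ : Submodule R (F (n + 1) ⊗[R] M)), (d n).rTensor M c = 0 →
      ∃ y ∈ 𝔪.comap (algebraMap A R) • (⊤ : Submodule A (Y (n + 1))), dY n y = 0 ∧
        ∃ v, δ (n + 1) y = c + (d (n + 1)).rTensor M v

/-- A quotient of `R` which is generated by one element and free of rank one over `A`
satisfies `Detects`. -/
theorem detects_of_bijective [∀ n, Module.Free R (F n)] {n : Ideal R} {Q : Type}
    [AddCommGroup Q] [Module R Q] [Module A Q] [IsScalarTower A R Q]
    (hdd : ∀ n x, d n (d (n + 1) x) = 0)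
    (hn : n ≤ 𝔪) (hA : ∀ r : R, ∃ a : A, r - algebraMap A R a ∈ n)
    (hQ : ∀ r ∈ n, ∀ q : Q, r • q = 0)
    (q₀ : Q) (hq₀ : Function.Bijective fun a : A => a • q₀) :
    Detects A 𝔪 F d Q := by
  have hproj : ∀ k, Module.Projective A (F k ⊗[R] Q) := by
    intro k
    let e : A ≃ₗ[A] Q := LinearEquiv.ofBijective (LinearMap.toSpanSingleton A Q q₀) hq₀
    let e' := (TensorProduct.equivFinsuppOfBasisLeft (N := Q)
      (Module.Free.chooseBasis R (F k))).restrictScalars A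
    exact Module.Projective.of_equiv ((Finsupp.mapRange.linearEquiv e).trans e'.symm)
  refine ⟨fun k => F k ⊗[R] Q, inferInstance, inferInstance,
    fun k => ((d k).rTensor Q).restrictScalars A, fun k => LinearMap.id, hproj, ?_, ?_, ?_⟩
  · intro k x
    change (d k).rTensor Q ((d (k + 1)).rTensor Q x) = 0
    rw [← LinearMap.comp_apply, ← LinearMap.rTensor_comp,
      show d k ∘ₗ d (k + 1) = 0 from LinearMap.ext (hdd k)]
    simp
  · intro k x
    rfl
  · intro k c hc hdc
    refine ⟨c, ?_, hdc, 0, by simp⟩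
    refine Submodule.smul_induction_on hc ?_ fun x y hx hy => add_mem hx hy
    intro r hr t _
    obtain ⟨a, ha⟩ := hA r
    have hkill (t : F (k + 1) ⊗[R] Q) : (r - algebraMap A R a) • t = 0 := by
      induction t with
      | zero => simp
      | tmul f q => rw [← TensorProduct.tmul_smul, hQ _ ha, TensorProduct.tmul_zero]
      | add x y hx hy => rw [smul_add, hx, hy, add_zero]
    have hrt := hkill t
    rw [sub_smul, sub_eq_zero, algebraMap_smul] at hrt
    rw [hrt]
    refine Submodule.smul_mem_smul ?_ trivial
    have := sub_mem hr (hn ha)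
    rwa [sub_sub_cancel] at this

variable {𝔪 F d}

/-- Dimension shifting for `Detects`, together with the resulting statement about
generators. -/
theorem Detects.step [∀ n, Module.Flat R (F n)] {M M' G : Type} [AddCommGroup M] [Module R M]
    [AddCommGroup M'] [Module R M'] [AddCommGroup G] [Module R G] [Module.Flat R G]
    (hM : Detects A 𝔪 F d M)
    (hdd : ∀ n, Function.Exact (d (n + 1)) (d n))
    (ε : F 0 →ₗ[R] R ⧸ 𝔪) (hε : Function.Surjective ε) (hdε : Function.Exact (d 0) ε)
    (ι : M' →ₗ[R] G) (ρ : G →ₗ[R] M) (hι : Function.Injective ι) (hρ : Function.Surjective ρ)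
    (hιρ : Function.Exact ι ρ)
    (hιm : ∀ x, ι x ∈ 𝔪 • (⊤ : Submodule R G))
    (hlin : ∀ n, ∀ y ∈ (𝔪 * 𝔪) • (⊤ : Submodule R (F n ⊗[R] G)),
      y ∈ LinearMap.range ((d n).rTensor G) →
      ∃ u ∈ 𝔪 • (⊤ : Submodule R (F (n + 1) ⊗[R] G)), (d n).rTensor G u = y) :
    Detects A 𝔪 F d M' ∧
      ∀ z, ι z ∈ (𝔪 * 𝔪) • (⊤ : Submodule R G) → z ∈ 𝔪 • (⊤ : Submodule R M') := by
  obtain ⟨Y, _, _, dY, δ, hproj, hdY, hδ, hdet⟩ := hM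
  have hιF : ∀ n, Function.Injective (ι.lTensor (F n)) := fun n =>
    Module.Flat.lTensor_preserves_injective_linearMap ι hι
  have hex : ∀ n, Function.Exact (ι.lTensor (F n)) (ρ.lTensor (F n)) := fun n =>
    lTensor_exact (F n) hιρ hρ
  have hρF : ∀ n, Function.Surjective (ρ.lTensor (F n)) := fun n =>
    LinearMap.lTensor_surjective (F n) hρ
  have hcomm : ∀ {P Q : Type} [AddCommGroup P] [Module R P] [AddCommGroup Q] [Module R Q]
      (f : P →ₗ[R] Q) (n) (x : F (n + 1) ⊗[R] P),
      f.lTensor (F n) ((d n).rTensor P x) = (d n).rTensor Q (f.lTensor (F (n + 1)) x) := by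
    intro P Q _ _ _ _ f n x
    rw [← LinearMap.comp_apply, ← LinearMap.comp_apply, LinearMap.lTensor_comp_rTensor,
      LinearMap.rTensor_comp_lTensor]
  have hddT : ∀ (P : Type) [AddCommGroup P] [Module R P] (n) (x : F (n + 2) ⊗[R] P),
      (d n).rTensor P ((d (n + 1)).rTensor P x) = 0 := by
    intro P _ _ n x
    rw [← LinearMap.comp_apply, ← LinearMap.rTensor_comp, (hdd n).linearMap_comp_eq_zero]
    simp
  have hs : ∀ n, ∃ s : Y n →ₗ[A] F n ⊗[R] G, ∀ x, ρ.lTensor (F n) (s x) = δ n x := fun n =>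
    have := hproj n
    exists_lift_of_range_le (δ n) ((ρ.lTensor (F n)).restrictScalars A)
      fun x => hρF n (δ n x)
  choose s hs using hs
  have hδ' : ∀ n, ∃ δ' : Y (n + 1) →ₗ[A] F n ⊗[R] M', ∀ x,
      ι.lTensor (F n) (δ' x) = (d n).rTensor G (s (n + 1) x) - s n (dY n x) := by
    intro n
    have := hproj (n + 1)
    refine exists_lift_of_range_le
      (((d n).rTensor G).restrictScalars A ∘ₗ s (n + 1) - s n ∘ₗ dY n)
      ((ι.lTensor (F n)).restrictScalars A) fun x => ?_
    refine (hex n _).1 ?_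
    change ρ.lTensor (F n) ((d n).rTensor G (s (n + 1) x) - s n (dY n x)) = 0
    rw [map_sub, hcomm, hs, hs, hδ, sub_self]
  choose δ' hδ' using hδ'
  have key : ∀ n (c : F n ⊗[R] M'), ι.lTensor (F n) c ∈ (𝔪 * 𝔪) • (⊤ : Submodule R (F n ⊗[R] G)) →
      ι.lTensor (F n) c ∈ LinearMap.range ((d n).rTensor G) →
      ∃ y ∈ 𝔪.comap (algebraMap A R) • (⊤ : Submodule A (Y (n + 1))), dY n y = 0 ∧
        ∃ v, δ' n y = c + (d n).rTensor M' v := by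
    intro n c hc hcr
    obtain ⟨u, hu, hdu⟩ := hlin n _ hc hcr
    obtain ⟨y, hy, hdy, v, hv⟩ := hdet n (ρ.lTensor (F (n + 1)) u)
      (map_mem_smul_top _ hu) (by rw [← hcomm, hdu]; exact (hex n).apply_apply_eq_zero c)
    obtain ⟨w, rfl⟩ := hρF (n + 2) v
    obtain ⟨t, ht⟩ := (hex (n + 1) (s (n + 1) y - u - (d (n + 1)).rTensor G w)).1 (by
      rw [map_sub, map_sub, hcomm, hs, hv]; abel)
    refine ⟨y, hy, hdy, t, hιF n ?_⟩
    rw [hδ', hdy, map_zero, sub_zero, map_add, hcomm, ht, map_sub, map_sub, hddT, hdu]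
    abel
  refine ⟨⟨fun n => Y (n + 1), inferInstance, inferInstance, fun n => -dY (n + 1), δ',
    fun n => hproj (n + 1), ?_, ?_, ?_⟩, ?_⟩
  · intro n x
    simp [hdY]
  · intro n x
    apply hιF n
    rw [hcomm, hδ', LinearMap.neg_apply, map_neg, map_neg, hδ', hdY, map_zero, sub_zero, map_sub,
      hddT, zero_sub]
  · intro n c hc hdc
    have hrange : LinearMap.range (ι.lTensor (F (n + 1))) ≤ 𝔪 • ⊤ := by
      rintro _ ⟨x, rfl⟩
      induction x with
      | zero => simp
      | tmul f q =>
        rw [LinearMap.lTensor_tmul]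
        exact map_mem_smul_top (TensorProduct.mk R (F (n + 1)) G f) (hιm q)
      | add x y hx hy => rw [map_add]; exact add_mem hx hy
    have hιc := Submodule.mem_map_of_mem (f := ι.lTensor (F (n + 1))) hc
    rw [Submodule.map_smul'', Submodule.map_top] at hιc
    have hιc' := Submodule.smul_mono le_rfl hrange hιc
    rw [← Submodule.mul_smul] at hιc'
    obtain ⟨y, hy, hdy, v, hv⟩ := key (n + 1) c hιc'
      ((Module.Flat.rTensor_exact G (hdd n) _).1 (by rw [← hcomm, hdc, map_zero]))
    exact ⟨y, hy, by simp [hdy], v, hv⟩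
  · intro z hz
    have hkill : ∀ {P : Type} [AddCommGroup P] [Module R P] (x : (R ⧸ 𝔪) ⊗[R] P),
        x ∈ 𝔪 • (⊤ : Submodule R ((R ⧸ 𝔪) ⊗[R] P)) → x = 0 := by
      intro P _ _ x hx
      refine Submodule.smul_induction_on hx ?_ fun x y hx hy => by rw [hx, hy, add_zero]
      intro r hr t ht
      clear ht
      induction t with
      | zero => simp
      | tmul f q =>
        obtain ⟨f, rfl⟩ := Ideal.Quotient.mk_surjective f
        rw [TensorProduct.smul_tmul', Algebra.smul_def, Ideal.Quotient.algebraMap_eq,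
          Ideal.Quotient.eq_zero_iff_mem.2 hr, zero_mul, TensorProduct.zero_tmul]
      | add x y hx hy => rw [smul_add, hx, hy, add_zero]
    obtain ⟨e, he⟩ := hε 1
    obtain ⟨y, hy, -, v, hv⟩ := key 0 (e ⊗ₜ z)
      (map_mem_smul_top (TensorProduct.mk R (F 0) G e) hz)
      ((rTensor_exact G hdε hε _).1 (hkill _ (map_mem_smul_top _
        (map_mem_smul_top (TensorProduct.mk R (F 0) G e)
          (Submodule.smul_mono_left Ideal.mul_le_left hz)))))
    have hδy : δ' 0 y ∈ 𝔪 • (⊤ : Submodule R (F 0 ⊗[R] M')) := by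
      refine Submodule.smul_induction_on hy ?_ fun x y hx hy => by
        rw [map_add]; exact add_mem hx hy
      intro a ha t _
      rw [map_smul, ← algebraMap_smul R a (δ' 0 t)]
      exact Submodule.smul_mem_smul ha trivial
    have h := congrArg (ε.rTensor M') hv
    rw [hkill _ (map_mem_smul_top _ hδy), map_add, (rTensor_exact M' hdε hε).apply_apply_eq_zero,
      add_zero, LinearMap.rTensor_tmul, he] at h
    have h' := congrArg (TensorProduct.quotTensorEquivQuotSMul M' 𝔪) h
    rw [map_zero, ← map_one (Ideal.Quotient.mk 𝔪),
      TensorProduct.quotTensorEquivQuotSMul_mk_tmul, one_smul] at h'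
    exact (Submodule.Quotient.mk_eq_zero _).1 h'.symm

end Detection

/-- Membership in `I • ⊤` of a free module is tested on coordinates. -/
theorem finsupp_mem_smul_top_iff {R σ : Type} [CommRing R] {I : Ideal R} {f : σ →₀ R} :
    f ∈ I • (⊤ : Submodule R (σ →₀ R)) ↔ ∀ s, f s ∈ I := by
  constructor
  · intro hf s
    have := map_mem_smul_top (Finsupp.lapply s : (σ →₀ R) →ₗ[R] R) hf
    rwa [smul_eq_mul, Ideal.mul_top] at this
  · intro hf
    rw [← f.sum_single]
    refine sum_mem fun s _ => ?_
    rw [← mul_one (f s), ← smul_eq_mul, ← Finsupp.smul_single]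
    exact Submodule.smul_mem_smul (hf s) trivial

section Graded

variable {K R : Type} [Field K] [CommRing R] [Algebra K R]
  {ℛ : ℤ × ℤ → Submodule K R}

theorem eq_zero_of_add_nonpos (hstd : IsStandardBigraded K R ℛ) {v : ℤ × ℤ}
    (hv : v.1 + v.2 ≤ 0) (hv0 : v ≠ 0) {x : R} (hx : x ∈ ℛ v) : x = 0 := by
  have : v.1 < 0 ∨ v.2 < 0 := by
    by_contra! h
    exact hv0 (Prod.ext (by simp; omega) (by simp; omega))
  rw [hstd.1 v this] at hx
  exact (Submodule.mem_bot K).1 hx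

theorem mem_irrelevant_of_mem {v : ℤ × ℤ} (hv : v ≠ 0) {x : R} (hx : x ∈ ℛ v) :
    x ∈ irrelevant ℛ :=
  Ideal.subset_span ⟨v, hv, hx⟩

theorem pow_le_restrictScalars_pow {P : Submodule K R} {I : Ideal R}
    (h : P ≤ I.restrictScalars K) (n : ℕ) : P ^ n ≤ (I ^ n).restrictScalars K := by
  induction n with
  | zero => intro x _; simp
  | succ n ih =>
    rw [pow_succ, pow_succ, Submodule.mul_le]
    exact fun a ha b hb => Ideal.mul_mem_mul (ih ha) (h hb)

theorem mem_irrelevant_mul_of_mem (hstd : IsStandardBigraded K R ℛ) {v : ℤ × ℤ}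
    (hv : 2 ≤ v.1 + v.2) {x : R} (hx : x ∈ ℛ v) : x ∈ irrelevant ℛ * irrelevant ℛ := by
  by_cases hneg : v.1 < 0 ∨ v.2 < 0
  · rw [hstd.1 v hneg] at hx
    rw [(Submodule.mem_bot K).1 hx]
    exact zero_mem _
  push Not at hneg
  have hle : ∀ w : ℤ × ℤ, w ≠ 0 → ℛ w ≤ (irrelevant ℛ).restrictScalars K :=
    fun w hw x hx => mem_irrelevant_of_mem hw hx
  rw [hstd.2.2 v hneg.1 hneg.2] at hx
  have hpow : x ∈ irrelevant ℛ ^ (v.1.toNat + v.2.toNat) := by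
    refine Submodule.mul_induction_on hx ?_ fun x y hx hy => add_mem hx hy
    intro a ha b hb
    rw [pow_add]
    exact Ideal.mul_mem_mul (pow_le_restrictScalars_pow (hle _ (by simp)) _ ha)
      (pow_le_restrictScalars_pow (hle _ (by simp)) _ hb)
  rw [← pow_two]
  exact Ideal.pow_le_pow_right (by omega) hpow

theorem span_le_irrelevant : Ideal.span (ℛ (0, 1) : Set R) ≤ irrelevant ℛ :=
  Ideal.span_le.2 fun _ hx => mem_irrelevant_of_mem (by simp) hx

theorem GradedFreeResolution.exact
    (res : GradedFreeResolution K R ℛ (R ⧸ irrelevant ℛ) (residueGrading K R ℛ)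
      (fun s => {v : ℤ × ℤ | v.1 + v.2 = (s : ℤ)})) (n : ℕ) :
    Function.Exact (res.d (n + 1)) (res.d n) :=
  LinearMap.exact_iff.2 (res.exact_succ n).symm

variable [GradedAlgebra ℛ]

theorem proj_mem (v : ℤ × ℤ) (r : R) : GradedAlgebra.proj ℛ v r ∈ ℛ v := by
  rw [GradedAlgebra.proj_apply]
  exact SetLike.coe_mem _

theorem proj_mul_of_right_mem {a b : R} {j : ℤ × ℤ} (hb : b ∈ ℛ j) (v : ℤ × ℤ) :
    GradedAlgebra.proj ℛ v (a * b) = GradedAlgebra.proj ℛ (v - j) a * b := by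
  simp only [GradedAlgebra.proj_apply]
  conv_lhs => rw [← sub_add_cancel v j]
  exact DirectSum.coe_decompose_mul_add_of_right_mem ℛ hb

theorem sum_proj_of_support_subset (r : R) {V : Finset (ℤ × ℤ)}
    (hV : ∀ v, GradedAlgebra.proj ℛ v r ≠ 0 → v ∈ V) :
    ∑ v ∈ V, GradedAlgebra.proj ℛ v r = r := by
  classical
  conv_rhs => rw [← DirectSum.sum_support_decompose ℛ r]
  simp only [GradedAlgebra.proj_apply] at hV ⊢
  refine (Finset.sum_subset (fun v hv => hV v ?_) fun v _ hv => ?_).symm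
  · simpa using hv
  · simpa using hv

theorem exists_sum_proj (r : R) : ∃ V : Finset (ℤ × ℤ),
    (∀ v, GradedAlgebra.proj ℛ v r ≠ 0 → v ∈ V) ∧ ∑ v ∈ V, GradedAlgebra.proj ℛ v r = r := by
  classical
  have h : ∀ v, GradedAlgebra.proj ℛ v r ≠ 0 → v ∈ (DirectSum.decompose ℛ r).support := by
    intro v hv
    rw [GradedAlgebra.proj_apply] at hv
    simpa using hv
  exact ⟨_, h, sum_proj_of_support_subset r h⟩

theorem mem_irrelevant_iff (hstd : IsStandardBigraded K R ℛ) {r : R} :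
    r ∈ irrelevant ℛ ↔ GradedAlgebra.proj ℛ 0 r = 0 := by
  constructor
  · intro hr
    refine Submodule.span_induction ?_ (map_zero _)
      (fun x y _ _ hx hy => by rw [map_add, hx, hy, add_zero]) ?_ hr
    · rintro x ⟨i, hi, hx⟩
      rw [GradedAlgebra.proj_apply]
      exact DirectSum.decompose_of_mem_ne ℛ hx hi
    · intro a x hx h
      obtain ⟨V, hV, hsum⟩ := exists_sum_proj (ℛ := ℛ) x
      rw [smul_eq_mul, ← hsum, Finset.mul_sum, map_sum]
      refine Finset.sum_eq_zero fun v _ => ?_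
      rw [proj_mul_of_right_mem (proj_mem v x)]
      by_cases hv0 : v = 0
      · rw [hv0, h, mul_zero]
      by_cases hv : v.1 + v.2 ≤ 0
      · rw [eq_zero_of_add_nonpos hstd hv hv0 (proj_mem v x), mul_zero]
      · rw [eq_zero_of_add_nonpos hstd (v := 0 - v) (by simp; omega) (by simpa using hv0)
          (proj_mem _ a), zero_mul]
  · intro hr
    obtain ⟨V, hV, hsum⟩ := exists_sum_proj (ℛ := ℛ) r
    rw [← hsum]
    refine sum_mem fun v _ => ?_
    by_cases hv0 : v = 0
    · rw [hv0, hr]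
      exact zero_mem _
    · exact mem_irrelevant_of_mem hv0 (proj_mem v r)

theorem proj_eq_zero_of_mem_irrelevant (hstd : IsStandardBigraded K R ℛ) {r : R}
    (hr : r ∈ irrelevant ℛ) {v : ℤ × ℤ} (hv : v.1 + v.2 ≤ 0) : GradedAlgebra.proj ℛ v r = 0 := by
  by_cases hv0 : v = 0
  · rw [hv0]
    exact (mem_irrelevant_iff hstd).1 hr
  · exact eq_zero_of_add_nonpos hstd hv hv0 (proj_mem v r)

theorem proj_eq_zero_of_mem_irrelevant_mul (hstd : IsStandardBigraded K R ℛ) {r : R}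
    (hr : r ∈ irrelevant ℛ * irrelevant ℛ) {v : ℤ × ℤ} (hv : v.1 + v.2 ≤ 1) :
    GradedAlgebra.proj ℛ v r = 0 := by
  refine Submodule.mul_induction_on hr ?_ fun x y hx hy => by rw [map_add, hx, hy, add_zero]
  intro a ha b hb
  obtain ⟨V, hV, hsum⟩ := exists_sum_proj (ℛ := ℛ) b
  rw [← hsum, Finset.mul_sum, map_sum]
  refine Finset.sum_eq_zero fun w _ => ?_
  rw [proj_mul_of_right_mem (proj_mem w b)]
  by_cases hw : w.1 + w.2 ≤ 0
  · rw [proj_eq_zero_of_mem_irrelevant hstd hb hw, mul_zero]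
  · rw [proj_eq_zero_of_mem_irrelevant hstd ha (v := v - w) (by simp; omega), zero_mul]

/-- A map of free modules with linear entries: an element of its range with entries in the
square of the irrelevant ideal is the image of an element with entries in the irrelevant
ideal. -/
theorem exists_mem_smul_top_of_linear (hstd : IsStandardBigraded K R ℛ) {σ σ' : Type}
    (d : (σ' →₀ R) →ₗ[R] (σ →₀ R))
    (hd : ∀ s t, ∃ v : ℤ × ℤ, v.1 + v.2 = 1 ∧ d (Finsupp.single s 1) t ∈ ℛ v) (f : σ' →₀ R)
    (hf : d f ∈ (irrelevant ℛ * irrelevant ℛ) • (⊤ : Submodule R (σ →₀ R))) :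
    ∃ u ∈ irrelevant ℛ • (⊤ : Submodule R (σ' →₀ R)), d u = d f := by
  set 𝔪 := irrelevant ℛ with h𝔪
  let f₀ : σ' →₀ R := f.mapRange (GradedAlgebra.proj ℛ 0) (map_zero _)
  have hsub : f - f₀ ∈ 𝔪 • (⊤ : Submodule R (σ' →₀ R)) := by
    rw [finsupp_mem_smul_top_iff]
    intro s
    rw [h𝔪, mem_irrelevant_iff hstd]
    simp only [f₀, Finsupp.sub_apply, Finsupp.mapRange_apply, map_sub]
    rw [GradedAlgebra.proj_apply ℛ 0 (GradedAlgebra.proj ℛ 0 (f s)),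
      DirectSum.decompose_of_mem_same ℛ (proj_mem 0 (f s)), sub_self]
  have happ : ∀ (g : σ' →₀ R) t, d g t = g.sum fun s r => r * d (Finsupp.single s 1) t := by
    intro g t
    conv_lhs => rw [← g.sum_single, map_finsuppSum, Finsupp.sum_apply]
    refine Finsupp.sum_congr fun s _ => ?_
    rw [← mul_one (g s), ← smul_eq_mul, ← Finsupp.smul_single, map_smul, Finsupp.smul_apply]
    simp
  have hdm : ∀ g, d g ∈ 𝔪 • (⊤ : Submodule R (σ →₀ R)) := by
    intro g
    rw [finsupp_mem_smul_top_iff]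
    intro t
    rw [happ]
    refine sum_mem fun s _ => Ideal.mul_mem_left _ _ ?_
    obtain ⟨v, hv, hmem⟩ := hd s t
    exact mem_irrelevant_of_mem (by rintro rfl; simp at hv) hmem
  have hsub' : d (f - f₀) ∈ (𝔪 * 𝔪) • (⊤ : Submodule R (σ →₀ R)) := by
    have h := Submodule.mem_map_of_mem (f := d) hsub
    rw [Submodule.map_smul'', Submodule.map_top] at h
    rw [Submodule.mul_smul]
    refine Submodule.smul_mono le_rfl ?_ h
    rintro _ ⟨g, rfl⟩
    exact hdm g
  refine ⟨f - f₀, hsub, ?_⟩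
  rw [map_sub, sub_eq_self]
  have hf₀ : d f₀ ∈ (𝔪 * 𝔪) • (⊤ : Submodule R (σ →₀ R)) := by
    have := sub_mem hf hsub'
    rwa [← map_sub, sub_sub_cancel] at this
  rw [finsupp_mem_smul_top_iff] at hf₀
  ext t
  obtain ⟨V, -, hV⟩ := exists_sum_proj (ℛ := ℛ) (d f₀ t)
  rw [← hV, Finsupp.zero_apply]
  refine Finset.sum_eq_zero fun w _ => ?_
  by_cases hw : w.1 + w.2 ≤ 1
  · exact proj_eq_zero_of_mem_irrelevant_mul hstd (hf₀ t) hw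
  rw [happ, Finsupp.sum, map_sum]
  refine Finset.sum_eq_zero fun s _ => ?_
  obtain ⟨v, hv, hmem⟩ := hd s t
  rw [GradedAlgebra.proj_apply]
  refine DirectSum.decompose_of_mem_ne ℛ (i := 0 + v) (SetLike.mul_mem_graded ?_ hmem) ?_
  · exact proj_mem 0 (f s)
  · rintro rfl
    simp at hw
    omega

/-- The conclusion of `exists_mem_smul_top_of_linear` is preserved by tensoring with a free
module. -/
theorem exists_mem_smul_top_rTensor {F F' τ : Type} [AddCommGroup F] [Module R F]
    [AddCommGroup F'] [Module R F'] {I J : Ideal R} (d : F' →ₗ[R] F)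
    (hd : ∀ f, d f ∈ J • (⊤ : Submodule R F) → ∃ u ∈ I • (⊤ : Submodule R F'), d u = d f)
    (y : F ⊗[R] (τ →₀ R)) (hy : y ∈ J • (⊤ : Submodule R (F ⊗[R] (τ →₀ R))))
    (hyr : y ∈ LinearMap.range (d.rTensor (τ →₀ R))) :
    ∃ u ∈ I • (⊤ : Submodule R (F' ⊗[R] (τ →₀ R))), d.rTensor (τ →₀ R) u = y := by
  classical
  obtain ⟨x, rfl⟩ := hyr
  let b : Module.Basis τ R (τ →₀ R) := Finsupp.basisSingleOne
  let e := TensorProduct.equivFinsuppOfBasisRight (M := F) b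
  let e' := TensorProduct.equivFinsuppOfBasisRight (M := F') b
  have hcoord : ∀ (x : F' ⊗[R] (τ →₀ R)) t, e (d.rTensor _ x) t = d (e' x t) := by
    intro x t
    induction x with
    | zero => simp
    | tmul f g =>
      simp [e, e']
    | add x y hx hy => simp [hx, hy]
  have hmem : ∀ t, d (e' x t) ∈ J • (⊤ : Submodule R F) := by
    intro t
    rw [← hcoord]
    exact map_mem_smul_top (Finsupp.lapply t ∘ₗ e.toLinearMap) hy
  choose u hu hdu using fun t => hd _ (hmem t)
  refine ⟨∑ t ∈ (e' x).support, u t ⊗ₜ b t, sum_mem fun t _ =>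
    map_mem_smul_top ((TensorProduct.mk R F' (τ →₀ R)).flip (b t)) (hu t), ?_⟩
  conv_rhs => rw [← e'.symm_apply_apply x,
    TensorProduct.equivFinsuppOfBasisRight_symm_apply, Finsupp.sum]
  simp only [map_sum, LinearMap.rTensor_tmul, hdu]

variable (ℛ) in
/-- The homogeneous component of degree `v` of an element of a graded free module. -/
noncomputable def freeComponent {τ : Type} (deg : τ → ℤ × ℤ) (v : ℤ × ℤ) (f : τ →₀ R) :
    τ →₀ R :=
  Finsupp.onFinset f.support (fun t => GradedAlgebra.proj ℛ (v - deg t) (f t)) fun t ht => by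
    rw [Finsupp.mem_support_iff]
    intro h
    simp [h] at ht

section FreeComponent

variable {τ : Type} (deg : τ → ℤ × ℤ) (v : ℤ × ℤ)

@[simp]
theorem freeComponent_apply (f : τ →₀ R) (t : τ) :
    freeComponent ℛ deg v f t = GradedAlgebra.proj ℛ (v - deg t) (f t) :=
  rfl

theorem freeComponent_add (f g : τ →₀ R) :
    freeComponent ℛ deg v (f + g) = freeComponent ℛ deg v f + freeComponent ℛ deg v g := by
  ext t
  simp

theorem freeComponent_zero : freeComponent ℛ deg v (0 : τ →₀ R) = 0 := by
  ext t
  simp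

theorem freeComponent_single (s : τ) (r : R) :
    freeComponent ℛ deg v (Finsupp.single s r) =
      Finsupp.single s (GradedAlgebra.proj ℛ (v - deg s) r) := by
  classical
  ext t
  by_cases h : s = t
  · subst h
    simp
  · simp [Finsupp.single_eq_of_ne' h]

theorem freeComponent_mem_freeGrading (f : τ →₀ R) :
    freeComponent ℛ deg v f ∈ freeGrading ℛ deg v :=
  fun t => proj_mem (v - deg t) (f t)

theorem freeComponent_of_mem {f : τ →₀ R} (hf : f ∈ freeGrading ℛ deg v) :
    freeComponent ℛ deg v f = f := by
  ext t
  rw [freeComponent_apply, GradedAlgebra.proj_apply]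
  exact DirectSum.decompose_of_mem_same ℛ (hf t)

theorem freeComponent_smul {i : ℤ × ℤ} {r : R} (hr : r ∈ ℛ i) (f : τ →₀ R) :
    freeComponent ℛ deg v (r • f) = r • freeComponent ℛ deg (v - i) f := by
  ext t
  rw [freeComponent_apply, Finsupp.smul_apply, Finsupp.smul_apply, freeComponent_apply,
    smul_eq_mul, smul_eq_mul, mul_comm, proj_mul_of_right_mem hr, mul_comm, sub_right_comm]

theorem freeComponent_smul_of_mem {i : ℤ × ℤ} (r : R) {f : τ →₀ R}
    (hf : f ∈ freeGrading ℛ deg i) :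
    freeComponent ℛ deg v (r • f) = GradedAlgebra.proj ℛ (v - i) r • f := by
  ext t
  rw [freeComponent_apply, Finsupp.smul_apply, Finsupp.smul_apply, smul_eq_mul, smul_eq_mul,
    proj_mul_of_right_mem (hf t), sub_sub_sub_cancel_right]

/-- An element of a graded free module lies in a submodule containing all its homogeneous
components. -/
theorem mem_of_freeComponent_mem {N : Submodule R (τ →₀ R)} {f : τ →₀ R}
    (h : ∀ v, freeComponent ℛ deg v f ∈ N) : f ∈ N := by
  classical
  choose V hV hsum using fun t => exists_sum_proj (ℛ := ℛ) (f t)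
  let W : Finset (ℤ × ℤ) := f.support.biUnion fun t => (V t).image (· + deg t)
  have hf : ∑ v ∈ W, freeComponent ℛ deg v f = f := by
    ext t
    rw [Finsupp.finsetSum_apply]
    simp only [freeComponent_apply]
    by_cases ht : f t = 0
    · simp [ht]
    have := sum_proj_of_support_subset (ℛ := ℛ) (f t) (V := W.image (· - deg t)) fun v hv =>
      Finset.mem_image.2 ⟨v + deg t, Finset.mem_biUnion.2 ⟨t, Finsupp.mem_support_iff.2 ht,
        Finset.mem_image_of_mem _ (hV t v hv)⟩, add_sub_cancel_right _ _⟩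
    rwa [Finset.sum_image fun _ _ _ _ h => sub_left_injective h] at this
  rw [← hf]
  exact sum_mem fun v _ => h v

/-- Maps of graded free modules commute with taking homogeneous components. -/
theorem freeComponent_linearCombination {τ' : Type} (deg' : τ' → ℤ × ℤ) (b : τ' → τ →₀ R)
    (hb : ∀ s, b s ∈ freeGrading ℛ deg (deg' s)) (f : τ' →₀ R) :
    freeComponent ℛ deg v (Finsupp.linearCombination R b f) =
      Finsupp.linearCombination R b (freeComponent ℛ deg' v f) := by
  induction f using Finsupp.induction_linear with
  | zero => rw [map_zero, freeComponent_zero, freeComponent_zero, map_zero]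
  | add f g hf hg =>
    rw [map_add, freeComponent_add, freeComponent_add, map_add, hf, hg]
  | single s r =>
    rw [freeComponent_single, Finsupp.linearCombination_single, Finsupp.linearCombination_single,
      freeComponent_smul_of_mem _ _ _ (hb s)]

end FreeComponent

/-- A graded submodule `Z` of a free module generated in total degree `p` is generated in total
degree `p + 1` as soon as `Z ∩ 𝔪² G ⊆ 𝔪 Z ⊆ Z ⊆ 𝔪 G`. -/
theorem le_span_of_mem_smul (hstd : IsStandardBigraded K R ℛ) {τ : Type} {deg : τ → ℤ × ℤ}
    {p : ℤ} (hdeg : ∀ t, (deg t).1 + (deg t).2 = p) {Z : Submodule R (τ →₀ R)}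
    (hom : ∀ f ∈ Z, ∀ v, freeComponent ℛ deg v f ∈ Z) (coeff : ∀ f ∈ Z, ∀ t, f t ∈ irrelevant ℛ)
    (hmul : ∀ z ∈ Z, z ∈ (irrelevant ℛ * irrelevant ℛ) • (⊤ : Submodule R (τ →₀ R)) →
      z ∈ irrelevant ℛ • Z) :
    Z ≤ Submodule.span R
      {z | z ∈ Z ∧ ∃ v : ℤ × ℤ, v.1 + v.2 = p + 1 ∧ z ∈ freeGrading ℛ deg v} := by
  set N := Submodule.span R
    {z | z ∈ Z ∧ ∃ v : ℤ × ℤ, v.1 + v.2 = p + 1 ∧ z ∈ freeGrading ℛ deg v} with hN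
  have key : ∀ (k : ℕ) (v : ℤ × ℤ), v.1 + v.2 ≤ p + k → ∀ f ∈ Z,
      freeComponent ℛ deg v f ∈ N := by
    intro k
    induction k with
    | zero =>
      intro v hv f hf
      have : freeComponent ℛ deg v f = 0 := by
        ext t
        have := hdeg t
        exact proj_eq_zero_of_mem_irrelevant hstd (coeff f hf t) (by simp at hv ⊢; omega)
      rw [this]
      exact zero_mem _
    | succ k ih =>
      intro v hv f hf
      by_cases hle : v.1 + v.2 ≤ p + k
      · exact ih v hle f hf
      push_cast at hv
      rcases Nat.eq_zero_or_pos k with rfl | hk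
      · exact Submodule.subset_span ⟨hom f hf v, v, by simp at hle hv; omega,
          freeComponent_mem_freeGrading deg v f⟩
      have hsq : freeComponent ℛ deg v f ∈ irrelevant ℛ • Z := by
        refine hmul _ (hom f hf v) (finsupp_mem_smul_top_iff.2 fun t => ?_)
        have := hdeg t
        exact mem_irrelevant_mul_of_mem hstd (v := v - deg t) (by simp; omega) (proj_mem _ _)
      rw [← freeComponent_of_mem deg v (freeComponent_mem_freeGrading deg v f)]
      refine Submodule.smul_induction_on hsq ?_ fun x y hx hy => by
        rw [freeComponent_add]
        exact add_mem hx hy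
      intro r hr z hz
      obtain ⟨V, -, hV⟩ := exists_sum_proj (ℛ := ℛ) r
      rw [← hV, Finset.sum_smul]
      refine Finset.sum_induction _ (fun g => freeComponent ℛ deg v g ∈ N)
        (fun x y hx hy => by
          rw [freeComponent_add]
          exact add_mem hx hy) (by rw [freeComponent_zero]; exact zero_mem _) fun i _ => ?_
      rw [freeComponent_smul deg v (proj_mem i r)]
      by_cases hi : i.1 + i.2 ≤ 0
      · rw [proj_eq_zero_of_mem_irrelevant hstd hr hi, zero_smul]
        exact zero_mem _
      · exact Submodule.smul_mem _ _ (ih (v - i) (by simp; omega) z hz)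
  intro f hf
  exact mem_of_freeComponent_mem deg fun v => key (v.1 + v.2 - p).toNat v (by omega) f hf

/-- Relations between `K`-linearly independent homogeneous elements of the same total degree
have coefficients in the irrelevant ideal. -/
theorem mem_irrelevant_of_linearCombination_eq_zero (hstd : IsStandardBigraded K R ℛ)
    {τ β : Type} {deg : τ → ℤ × ℤ} {b : β → τ →₀ R} (hli : LinearIndependent K b)
    {deg' : β → ℤ × ℤ} {q : ℤ} (hdeg' : ∀ s, (deg' s).1 + (deg' s).2 = q)
    (hb : ∀ s, b s ∈ freeGrading ℛ deg (deg' s)) {f : β →₀ R}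
    (hf : Finsupp.linearCombination R b f = 0) (s : β) : f s ∈ irrelevant ℛ := by
  rw [mem_irrelevant_iff hstd]
  set g := freeComponent ℛ deg' (deg' s) f with hg
  have hg0 : Finsupp.linearCombination R b g = 0 := by
    rw [hg, ← freeComponent_linearCombination deg _ deg' b hb, hf, freeComponent_zero]
  have hscalar : ∀ t, ∃ c : K, algebraMap K R c = g t := by
    intro t
    have hmem : g t ∈ ℛ (deg' s - deg' t) := proj_mem _ _
    by_cases h0 : deg' s - deg' t = 0
    · rw [h0, ← Prod.mk_zero_zero, hstd.2.1, Submodule.mem_one] at hmem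
      exact hmem
    · have h1 := hdeg' s
      have h2 := hdeg' t
      exact ⟨0, by rw [map_zero, eq_zero_of_add_nonpos hstd (by simp; omega) h0 hmem]⟩
  choose c hc using hscalar
  by_cases hs : s ∈ g.support
  · have := linearIndependent_iff'.1 hli g.support c (by
      rw [← hg0, Finsupp.linearCombination_apply, Finsupp.sum]
      exact Finset.sum_congr rfl fun t _ => by rw [← hc, algebraMap_smul]) s hs
    have h := hc s
    rw [this, map_zero, hg, freeComponent_apply, sub_self] at h
    exact h.symm
  · rw [Finsupp.notMem_support_iff, hg, freeComponent_apply, sub_self] at hs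
    exact hs

section Step

variable (A : Type) [CommRing A] [Algebra A R]
  (res : GradedFreeResolution K R ℛ (R ⧸ irrelevant ℛ) (residueGrading K R ℛ)
    (fun s => {v : ℤ × ℤ | v.1 + v.2 = (s : ℤ)}))

/-- The differentials of a linear resolution satisfy the conclusion of
`exists_mem_smul_top_of_linear`. -/
theorem GradedFreeResolution.exists_mem_smul_top (hstd : IsStandardBigraded K R ℛ) (n : ℕ)
    (f : res.σ (n + 1) →₀ R)
    (hf : res.d n f ∈ (irrelevant ℛ * irrelevant ℛ) • (⊤ : Submodule R (res.σ n →₀ R))) :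
    ∃ u ∈ irrelevant ℛ • (⊤ : Submodule R (res.σ (n + 1) →₀ R)), res.d n u = res.d n f := by
  classical
  refine exists_mem_smul_top_of_linear hstd (res.d n) (fun s t => ?_) f hf
  have hs : (res.deg (n + 1) s).1 + (res.deg (n + 1) s).2 = ((n + 1 : ℕ) : ℤ) :=
    res.deg_mem (n + 1) s
  have ht : (res.deg n t).1 + (res.deg n t).2 = (n : ℤ) := res.deg_mem n t
  refine ⟨res.deg (n + 1) s - res.deg n t, by push_cast at hs; simp; omega,
    res.d_graded n (res.deg (n + 1) s) _ (fun i => ?_) t⟩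
  by_cases hi : s = i
  · subst hi
    rw [Finsupp.single_eq_same, sub_self]
    exact SetLike.GradedOne.one_mem
  · rw [Finsupp.single_eq_of_ne' hi]
    exact zero_mem _

/-- A graded submodule `Z` of a graded free module `τ →₀ R` generated in total degree `p`, such
that `(τ →₀ R) ⧸ Z` satisfies `Detects`. -/
structure LinearStage (p : ℕ) where
  τ : Type
  deg : τ → ℤ × ℤ
  Z : Submodule R (τ →₀ R)
  deg_add : ∀ t, (deg t).1 + (deg t).2 = (p : ℤ)
  hom : ∀ f ∈ Z, ∀ v, freeComponent ℛ deg v f ∈ Z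
  coeff : ∀ f ∈ Z, ∀ t, f t ∈ irrelevant ℛ
  detects : Detects A (irrelevant ℛ) (fun n => res.σ n →₀ R) res.d ((τ →₀ R) ⧸ Z)

variable {A res}

theorem LinearStage.exists_succ (hstd : IsStandardBigraded K R ℛ) {p : ℕ}
    (S : LinearStage A res p) : ∃ (S' : LinearStage A res (p + 1))
      (d : (S'.τ →₀ R) →ₗ[R] (S.τ →₀ R)), LinearMap.range d = S.Z ∧ LinearMap.ker d = S'.Z ∧
        IsGradedMap (K := K) (freeGrading ℛ S'.deg) (freeGrading ℛ S.deg) d := by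
  have step {M' : Type} [AddCommGroup M'] [Module R M'] (ι : M' →ₗ[R] (S.τ →₀ R))
      (hι : Function.Injective ι) (hr : LinearMap.range ι = S.Z) :=
    S.detects.step res.exact res.aug res.aug_surjective (LinearMap.exact_iff.2 res.exact_zero.symm)
      ι S.Z.mkQ hι S.Z.mkQ_surjective (LinearMap.exact_iff.2 (by rw [S.Z.ker_mkQ, hr]))
      (fun x => finsupp_mem_smul_top_iff.2 (S.coeff _ (hr ▸ LinearMap.mem_range_self ι x)))
      fun n => exists_mem_smul_top_rTensor (res.d n) (res.exists_mem_smul_top hstd n)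
  have hle := le_span_of_mem_smul hstd S.deg_add S.hom S.coeff fun z hz hzm => by
    have := (step S.Z.subtype S.Z.subtype_injective S.Z.range_subtype).2 (⟨z, hz⟩ : S.Z) hzm
    have := Submodule.mem_map_of_mem (f := S.Z.subtype) this
    rwa [Submodule.map_smul'', Submodule.map_top, S.Z.range_subtype] at this
  set gens := {z | z ∈ S.Z ∧ ∃ v : ℤ × ℤ, v.1 + v.2 = (p : ℤ) + 1 ∧ z ∈ freeGrading ℛ S.deg v}
  obtain ⟨b, hbsub, hbspan, hli⟩ := exists_linearIndependent K gens
  choose hbZ deg hdeg hmem using fun s : b => hbsub s.2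
  let d : (b →₀ R) →ₗ[R] (S.τ →₀ R) := Finsupp.linearCombination R Subtype.val
  have hrange : LinearMap.range d = S.Z := by
    rw [Finsupp.range_linearCombination, Subtype.range_coe]
    refine le_antisymm (Submodule.span_le.2 fun z hz => hbZ ⟨z, hz⟩)
      (hle.trans (Submodule.span_le.2 fun z hz => ?_))
    have : z ∈ Submodule.span K b := hbspan ▸ Submodule.subset_span hz
    exact Submodule.span_le_restrictScalars K R b this
  have hcomp := fun v => freeComponent_linearCombination (ℛ := ℛ) S.deg v deg Subtype.val hmem
  refine ⟨⟨b, deg, LinearMap.ker d, fun s => by rw [hdeg]; simp, fun f hf v => ?_,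
    fun f hf => mem_irrelevant_of_linearCombination_eq_zero hstd hli hdeg hmem hf, ?_⟩,
    d, hrange, rfl, fun j f hf => ?_⟩
  · rw [LinearMap.mem_ker] at hf ⊢
    rw [← hcomp, show Finsupp.linearCombination R Subtype.val f = 0 from hf, freeComponent_zero]
  · refine (step ((LinearMap.ker d).liftQ d le_rfl) ?_ ?_).1
    · rw [← LinearMap.ker_eq_bot, Submodule.ker_liftQ_eq_bot _ _ _ le_rfl]
    · rw [Submodule.range_liftQ, hrange]
  · rw [← freeComponent_of_mem deg j hf, ← hcomp]
    exact freeComponent_mem_freeGrading _ _ _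

end Step

section Base

theorem proj_eq_zero_of_mem_span (hstd : IsStandardBigraded K R ℛ) {r : R}
    (hr : r ∈ Ideal.span (ℛ (0, 1) : Set R)) :
    ∀ v : ℤ × ℤ, v.2 ≤ 0 → GradedAlgebra.proj ℛ v r = 0 := by
  refine Submodule.span_induction ?_ (fun _ _ => map_zero _)
    (fun x y _ _ hx hy v hv => by rw [map_add, hx v hv, hy v hv, add_zero]) ?_ hr
  · intro x hx v hv
    rw [GradedAlgebra.proj_apply]
    exact DirectSum.decompose_of_mem_ne ℛ hx (by rintro rfl; simp at hv)
  · intro a x _ hx v hv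
    obtain ⟨V, -, hV⟩ := exists_sum_proj (ℛ := ℛ) x
    rw [smul_eq_mul, ← hV, Finset.mul_sum, map_sum]
    refine Finset.sum_eq_zero fun w _ => ?_
    rw [proj_mul_of_right_mem (proj_mem w x)]
    by_cases hw : w.2 ≤ 0
    · rw [hx w hw, mul_zero]
    · have : GradedAlgebra.proj ℛ (v - w) a ∈ ℛ (v - w) := proj_mem _ _
      rw [hstd.1 _ (Or.inr (by simp; omega))] at this
      rw [(Submodule.mem_bot K).1 this, zero_mul]

theorem proj_eq_zero_of_mem_adjoin {a : R} (ha : a ∈ Algebra.adjoin K (ℛ (1, 0) : Set R)) :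
    ∀ v : ℤ × ℤ, v.2 ≠ 0 → GradedAlgebra.proj ℛ v a = 0 := by
  refine Algebra.adjoin_induction ?_ ?_
    (fun x y _ _ hx hy v hv => by rw [map_add, hx v hv, hy v hv, add_zero]) ?_ ha
  · intro x hx v hv
    rw [GradedAlgebra.proj_apply]
    exact DirectSum.decompose_of_mem_ne ℛ hx (by rintro rfl; simp at hv)
  · intro c v hv
    rw [GradedAlgebra.proj_apply]
    exact DirectSum.decompose_of_mem_ne ℛ (SetLike.algebraMap_mem_graded ℛ c)
      (by rintro rfl; simp at hv)
  · intro x y _ _ hx hy v hv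
    obtain ⟨V, -, hV⟩ := exists_sum_proj (ℛ := ℛ) y
    rw [← hV, Finset.mul_sum, map_sum]
    refine Finset.sum_eq_zero fun w _ => ?_
    rw [proj_mul_of_right_mem (proj_mem w y)]
    by_cases hw : w.2 = 0
    · rw [hx (v - w) (by simpa [hw] using hv), zero_mul]
    · rw [hy w hw, mul_zero]

theorem eq_zero_of_mem_adjoin_of_mem_span (hstd : IsStandardBigraded K R ℛ) {a : R}
    (ha : a ∈ Algebra.adjoin K (ℛ (1, 0) : Set R)) (hr : a ∈ Ideal.span (ℛ (0, 1) : Set R)) :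
    a = 0 := by
  obtain ⟨V, -, hV⟩ := exists_sum_proj (ℛ := ℛ) a
  rw [← hV]
  refine Finset.sum_eq_zero fun w _ => ?_
  by_cases hw : w.2 = 0
  · exact proj_eq_zero_of_mem_span hstd hr w hw.le
  · exact proj_eq_zero_of_mem_adjoin ha w hw

theorem exists_sub_mem_span (hstd : IsStandardBigraded K R ℛ) (r : R) :
    ∃ a : Algebra.adjoin K (ℛ (1, 0) : Set R), r - (a : R) ∈ Ideal.span (ℛ (0, 1) : Set R) := by
  obtain ⟨V, -, hV⟩ := exists_sum_proj (ℛ := ℛ) r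
  rw [← hV]
  refine Finset.sum_induction _
    (fun x => ∃ a : Algebra.adjoin K (ℛ (1, 0) : Set R),
      x - (a : R) ∈ Ideal.span (ℛ (0, 1) : Set R))
    ?_ ⟨0, by simp⟩ fun v _ => ?_
  · rintro x y ⟨a, ha⟩ ⟨b, hb⟩
    refine ⟨a + b, ?_⟩
    have := add_mem ha hb
    rwa [← add_sub_add_comm] at this
  have hmem : GradedAlgebra.proj ℛ v r ∈ ℛ v := proj_mem v r
  by_cases hneg : v.1 < 0 ∨ v.2 < 0
  · rw [hstd.1 v hneg] at hmem
    exact ⟨0, by rw [(Submodule.mem_bot K).1 hmem]; simp⟩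
  push Not at hneg
  rw [hstd.2.2 v hneg.1 hneg.2] at hmem
  by_cases h0 : v.2 = 0
  · rw [h0, Int.toNat_zero, pow_zero, mul_one] at hmem
    have hpow : ∀ k : ℕ, ℛ (1, 0) ^ k ≤
        Subalgebra.toSubmodule (Algebra.adjoin K (ℛ (1, 0) : Set R)) := by
      intro k
      induction k with
      | zero =>
        rw [pow_zero, Submodule.one_le]
        exact one_mem (Algebra.adjoin K (ℛ (1, 0) : Set R))
      | succ k ih =>
        rw [pow_succ, Submodule.mul_le]
        exact fun a ha b hb => Subalgebra.mul_mem _ (ih ha) (Algebra.subset_adjoin hb)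
    exact ⟨⟨_, hpow _ hmem⟩, by simp⟩
  · refine ⟨0, ?_⟩
    have hle : ℛ (0, 1) ≤ (Ideal.span (ℛ (0, 1) : Set R)).restrictScalars K :=
      fun x hx => Ideal.subset_span hx
    rw [ZeroMemClass.coe_zero, sub_zero]
    refine Submodule.mul_induction_on hmem (fun a _ b hb => Ideal.mul_mem_left _ _ ?_)
      fun x y hx hy => add_mem hx hy
    exact Ideal.pow_le_self (by omega) (pow_le_restrictScalars_pow hle _ hb)

theorem proj_mem_span {r : R} (hr : r ∈ Ideal.span (ℛ (0, 1) : Set R)) (v : ℤ × ℤ) :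
    GradedAlgebra.proj ℛ v r ∈ Ideal.span (ℛ (0, 1) : Set R) := by
  rw [GradedAlgebra.proj_apply]
  exact Ideal.homogeneous_span ℛ _ (fun x hx => ⟨_, hx⟩) v hr

variable (res : GradedFreeResolution K R ℛ (R ⧸ irrelevant ℛ) (residueGrading K R ℛ)
    (fun s => {v : ℤ × ℤ | v.1 + v.2 = (s : ℤ)}))

/-- The stage with free module `R` and submodule the ideal generated by `ℛ (0, 1)`. -/
noncomputable def LinearStage.base (hstd : IsStandardBigraded K R ℛ) :
    LinearStage (Algebra.adjoin K (ℛ (1, 0) : Set R)) res 0 where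
  τ := Unit
  deg _ := 0
  Z := Submodule.comap (Finsupp.lapply ()) (Ideal.span (ℛ (0, 1) : Set R))
  deg_add _ := by simp
  hom f hf v := proj_mem_span hf _
  coeff f hf _ := span_le_irrelevant hf
  detects := by
    set n := Ideal.span (ℛ (0, 1) : Set R) with hn
    set Z : Submodule R (Unit →₀ R) := Submodule.comap (Finsupp.lapply ()) n with hZ
    have hsmul : ∀ a : Algebra.adjoin K (ℛ (1, 0) : Set R),
        a • Z.mkQ (Finsupp.single () 1) = Z.mkQ (Finsupp.single () (a : R)) := by
      intro a
      rw [← algebraMap_smul R a, ← map_smul, Finsupp.smul_single, smul_eq_mul, mul_one]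
      rfl
    have hmkQ : ∀ f g : Unit →₀ R, Z.mkQ f = Z.mkQ g ↔ f () - g () ∈ n := by
      intro f g
      exact Submodule.Quotient.eq Z
    refine detects_of_bijective _ _ _ (fun n x => (res.exact n).apply_apply_eq_zero x)
      span_le_irrelevant (exists_sub_mem_span hstd) (fun r hr q => ?_)
      (Z.mkQ (Finsupp.single () 1)) ⟨fun a b hab => ?_, fun q => ?_⟩
    · obtain ⟨f, rfl⟩ := Z.mkQ_surjective q
      rw [← map_smul, ← map_zero Z.mkQ, hmkQ]
      simpa using Ideal.mul_mem_right (f ()) n hr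
    · simp only [hsmul, hmkQ, Finsupp.single_eq_same] at hab
      exact Subtype.ext (sub_eq_zero.1
        (eq_zero_of_mem_adjoin_of_mem_span hstd (sub_mem a.2 b.2) hab))
    · obtain ⟨f, rfl⟩ := Z.mkQ_surjective q
      obtain ⟨a, ha⟩ := exists_sub_mem_span hstd (f ())
      refine ⟨a, ?_⟩
      simp only [hsmul, hmkQ, Finsupp.single_eq_same]
      rwa [← neg_mem_iff, neg_sub]

end Base

/-- Splicing a sequence of linear stages into a resolution. -/
theorem LinearStage.nonempty_resolution {A : Type} [CommRing A] [Algebra A R]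
    {res : GradedFreeResolution K R ℛ (R ⧸ irrelevant ℛ) (residueGrading K R ℛ)
      (fun s => {v : ℤ × ℤ | v.1 + v.2 = (s : ℤ)})}
    (hstd : IsStandardBigraded K R ℛ) (S₀ : LinearStage A res 0) {I : Ideal R}
    (e : (S₀.τ →₀ R) ≃ₗ[R] R) (he : ∀ v, ∀ f ∈ freeGrading ℛ S₀.deg v, e f ∈ ℛ v)
    (hZ : ∀ f, f ∈ S₀.Z ↔ e f ∈ I) :
    Nonempty (GradedFreeResolution K R ℛ I (idealComponent ℛ I)
      (fun i => {v : ℤ × ℤ | v.1 + v.2 = (i : ℤ) + 1})) := by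
  choose next d hrange hker hgraded using
    fun (p : ℕ) (S : LinearStage A res p) => S.exists_succ hstd
  let S : ∀ p, LinearStage A res p := fun p => Nat.rec S₀ next p
  have hmem : ∀ f, e (d 0 S₀ f) ∈ I := fun f =>
    (hZ _).1 (hrange 0 S₀ ▸ LinearMap.mem_range_self (d 0 S₀) f)
  exact ⟨{
    σ := fun i => (S (i + 1)).τ
    deg := fun i => (S (i + 1)).deg
    deg_mem := fun i t => by
      have := (S (i + 1)).deg_add t
      push_cast at this
      exact this
    aug := (e.toLinearMap ∘ₗ d 0 S₀).codRestrict I hmem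
    d := fun i => d (i + 1) (S (i + 1))
    aug_surjective := by
      rintro ⟨x, hx⟩
      have : e.symm x ∈ LinearMap.range (d 0 S₀) := by
        rw [hrange, hZ, e.apply_symm_apply]
        exact hx
      obtain ⟨f, hf⟩ := this
      exact ⟨f, Subtype.ext (by simp [hf])⟩
    aug_graded := fun v f hf => he v _ (hgraded 0 S₀ v f hf)
    d_graded := fun i => hgraded (i + 1) (S (i + 1))
    exact_zero := by
      rw [LinearMap.ker_codRestrict, LinearEquiv.ker_comp]
      exact (hrange 1 (S 1)).trans (hker 0 S₀).symm
    exact_succ := fun i =>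
      (hrange (i + 2) (S (i + 2))).trans (hker (i + 1) (S (i + 1))).symm }⟩

end Graded

/-- **Lemma.**  Let `R` be a standard bigraded Koszul `K`-algebra and
`n_y = (y_1, …, y_m) ⊆ R` the ideal generated by the component of bidegree `(0,1)`
(the residue classes of the `y`-variables).  Then `n_y` has a bigraded `1`-linear
free `R`-resolution: `Tor_i^R(n_y, K)_{(j,k)} = 0` whenever `j + k ≠ i + 1`,
equivalently `n_y` admits a bigraded free resolution whose `i`-th free module has
generators in bidegrees of total degree `i + 1`. -/
theorem ny_linear_resolution
    (K R : Type) [Field K] [CommRing R] [Algebra K R]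
    (ℛ : ℤ × ℤ → Submodule K R) [GradedAlgebra ℛ]
    (hstd : IsStandardBigraded K R ℛ)
    (hkoszul : IsKoszulBi K R ℛ) :
    Nonempty (GradedFreeResolution K R ℛ
      ↥(Ideal.span (ℛ (0, 1) : Set R))
      (idealComponent ℛ (Ideal.span (ℛ (0, 1) : Set R)))
      (fun i => {v : ℤ × ℤ | v.1 + v.2 = (i : ℤ) + 1})) := by
  obtain ⟨res⟩ := hkoszul
  let e : (Unit →₀ R) ≃ₗ[R] R := Finsupp.uniqueLinearEquiv R R ()
  refine (LinearStage.base res hstd).nonempty_resolution hstd e (fun v f hf => ?_)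
    fun f => Iff.rfl
  have := hf ()
  rwa [show v - (LinearStage.base res hstd).deg () = v from sub_zero v] at this
end
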